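/- arXiv:1604.04952 — 9 statements merged into one kernel-verified Lean document; each statement's English description precedes it below -/
import Mathlib

section
/- Let Ξ = (Ξ_1,…,Ξ_g) be a convexotonic g-tuple of g×g complex matrices and let p and q be the associated convexotonic maps. Then p and q are inverses of one another: for every n and every X ∈ M_n(ℂ)^g such that I − Λ_Ξ(X) is invertible, the matrix I + Λ_Ξ(p(X)) is invertible and q(p(X)) = X; symmetrically, for every Y ∈ M_n(ℂ)^g such that I + Λ_Ξ(Y) is invertible, the matrix I − Λ_Ξ(q(Y)) is invertible and p(q(Y)) = Y. -/
open scoped Kronecker Matrix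

/-- `Λ_Ξ(X) = Σ_j Ξ_j ⊗ X_j`. -/
noncomputable def lamEval {g d n : ℕ} (A : Fin g → Matrix (Fin d) (Fin d) ℂ)
    (X : Fin g → Matrix (Fin n) (Fin n) ℂ) : Matrix (Fin d × Fin n) (Fin d × Fin n) ℂ :=
  ∑ j : Fin g, (A j) ⊗ₖ (X j)

/-- The `(j,i)` block (an `n × n` matrix) of a `g×g` block matrix with `n×n` blocks. -/
def blk {g n : ℕ} (M : Matrix (Fin g × Fin n) (Fin g × Fin n) ℂ) (j i : Fin g) :
    Matrix (Fin n) (Fin n) ℂ :=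
  Matrix.of fun a b => M (j, a) (i, b)

/-- The convexotonic map `p(X)_i = Σ_j X_j · [(I − Λ_Ξ(X))⁻¹]_{j,i}`. -/
noncomputable def ctP {g n : ℕ} (Ξ : Fin g → Matrix (Fin g) (Fin g) ℂ)
    (X : Fin g → Matrix (Fin n) (Fin n) ℂ) : Fin g → Matrix (Fin n) (Fin n) ℂ :=
  fun i => ∑ j : Fin g, X j * blk ((1 - lamEval Ξ X)⁻¹) j i

/-- The convexotonic map `q(X)_i = Σ_j X_j · [(I + Λ_Ξ(X))⁻¹]_{j,i}`. -/
noncomputable def ctQ {g n : ℕ} (Ξ : Fin g → Matrix (Fin g) (Fin g) ℂ)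
    (X : Fin g → Matrix (Fin n) (Fin n) ℂ) : Fin g → Matrix (Fin n) (Fin n) ℂ :=
  fun i => ∑ j : Fin g, X j * blk ((1 + lamEval Ξ X)⁻¹) j i

/-- A `g`-tuple of `g × g` matrices is convexotonic if
`Ξ_k Ξ_j = Σ_s (Ξ_j)_{k,s} Ξ_s` for all `j, k`. -/
def Convexotonic {g : ℕ} (Ξ : Fin g → Matrix (Fin g) (Fin g) ℂ) : Prop :=
  ∀ j k : Fin g, Ξ k * Ξ j = ∑ s : Fin g, (Ξ j) k s • Ξ s

/-- The row `[X_1 ⋯ X_g]` of `n × n` matrices multiplied on the right by a block matrix. -/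
def rowMul {g n : ℕ} (X : Fin g → Matrix (Fin n) (Fin n) ℂ)
    (M : Matrix (Fin g × Fin n) (Fin g × Fin n) ℂ) : Fin g → Matrix (Fin n) (Fin n) ℂ :=
  fun i => ∑ j : Fin g, X j * blk M j i

theorem rowMul_apply {g n : ℕ} (X : Fin g → Matrix (Fin n) (Fin n) ℂ)
    (M : Matrix (Fin g × Fin n) (Fin g × Fin n) ℂ) (i : Fin g) (a b : Fin n) :
    rowMul X M i a b = ∑ x : Fin g × Fin n, X x.1 a x.2 * M x (i, b) := by
  simp [rowMul, blk, Matrix.sum_apply, Matrix.mul_apply, Fintype.sum_prod_type]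

theorem rowMul_one {g n : ℕ} (X : Fin g → Matrix (Fin n) (Fin n) ℂ) : rowMul X 1 = X := by
  ext i a b
  simp [rowMul_apply, Matrix.one_apply]

theorem rowMul_add {g n : ℕ} (X : Fin g → Matrix (Fin n) (Fin n) ℂ)
    (M N : Matrix (Fin g × Fin n) (Fin g × Fin n) ℂ) :
    rowMul X (M + N) = rowMul X M + rowMul X N := by
  ext i a b
  simp [rowMul_apply, mul_add, Finset.sum_add_distrib]

theorem rowMul_sub {g n : ℕ} (X : Fin g → Matrix (Fin n) (Fin n) ℂ)
    (M N : Matrix (Fin g × Fin n) (Fin g × Fin n) ℂ) :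
    rowMul X (M - N) = rowMul X M - rowMul X N := by
  ext i a b
  simp [rowMul_apply, mul_sub, Finset.sum_sub_distrib]

theorem rowMul_rowMul {g n : ℕ} (X : Fin g → Matrix (Fin n) (Fin n) ℂ)
    (M N : Matrix (Fin g × Fin n) (Fin g × Fin n) ℂ) :
    rowMul (rowMul X M) N = rowMul X (M * N) := by
  ext i a b
  simp only [rowMul_apply, Matrix.mul_apply, Finset.sum_mul, Finset.mul_sum, mul_assoc]
  exact Finset.sum_comm

theorem lamEval_add {g d n : ℕ} (A : Fin g → Matrix (Fin d) (Fin d) ℂ)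
    (X Y : Fin g → Matrix (Fin n) (Fin n) ℂ) :
    lamEval A (X + Y) = lamEval A X + lamEval A Y := by
  simp [lamEval, Matrix.kronecker_add, Finset.sum_add_distrib]

theorem rowMul_lamEval {g n : ℕ} (A : Fin g → Matrix (Fin g) (Fin g) ℂ)
    (X Y : Fin g → Matrix (Fin n) (Fin n) ℂ) (i : Fin g) :
    rowMul X (lamEval A Y) i = ∑ j, ∑ k, A k j i • (X j * Y k) := by
  refine Finset.sum_congr rfl fun j _ => ?_
  have h : blk (lamEval A Y) j i = ∑ k, A k j i • Y k := by
    ext a b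
    simp [blk, lamEval, Matrix.sum_apply]
  simp [h, Finset.mul_sum]

/-- For a convexotonic tuple, `Λ_Ξ` turns row multiplication by `Λ_Ξ(Y)` into a product. -/
theorem Convexotonic.lamEval_rowMul_lamEval {g n : ℕ} {Ξ : Fin g → Matrix (Fin g) (Fin g) ℂ}
    (hΞ : Convexotonic Ξ) (X Y : Fin g → Matrix (Fin n) (Fin n) ℂ) :
    lamEval Ξ (rowMul X (lamEval Ξ Y)) = lamEval Ξ X * lamEval Ξ Y := by
  have h : lamEval Ξ X * lamEval Ξ Y =
      ∑ j, ∑ k, ∑ i, Ξ k j i • (Ξ i ⊗ₖ (X j * Y k)) := by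
    simp only [lamEval, Finset.sum_mul_sum, ← Matrix.mul_kronecker_mul, hΞ _ _]
    refine Finset.sum_congr rfl fun j _ => Finset.sum_congr rfl fun k _ => ?_
    ext ⟨a, c⟩ ⟨b, d⟩
    simp [Matrix.sum_apply, Finset.sum_mul, mul_assoc]
  have h' : lamEval Ξ (rowMul X (lamEval Ξ Y)) =
      ∑ i, ∑ j, ∑ k, Ξ k j i • (Ξ i ⊗ₖ (X j * Y k)) := by
    unfold lamEval
    refine Finset.sum_congr rfl fun i _ => ?_
    have := rowMul_lamEval Ξ X Y i
    unfold lamEval at this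
    rw [this]
    ext ⟨a, c⟩ ⟨b, d⟩
    simp [Matrix.sum_apply, Finset.mul_sum, mul_left_comm]
  rw [h, h', Finset.sum_comm]
  exact Finset.sum_congr rfl fun j _ => Finset.sum_comm

/-- The convexotonic maps `p` and `q` associated to a convexotonic tuple `Ξ` are inverses
of one another wherever they are defined. -/
theorem convexotonic_maps_inverse {g : ℕ} (Ξ : Fin g → Matrix (Fin g) (Fin g) ℂ)
    (hΞ : Convexotonic Ξ) :
    ∀ (n : ℕ),
      (∀ X : Fin g → Matrix (Fin n) (Fin n) ℂ, IsUnit (1 - lamEval Ξ X) →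
        IsUnit (1 + lamEval Ξ (ctP Ξ X)) ∧ ctQ Ξ (ctP Ξ X) = X) ∧
      (∀ Y : Fin g → Matrix (Fin n) (Fin n) ℂ, IsUnit (1 + lamEval Ξ Y) →
        IsUnit (1 - lamEval Ξ (ctQ Ξ Y)) ∧ ctP Ξ (ctQ Ξ Y) = Y) := by
  intro n
  refine ⟨fun X hX => ?_, fun Y hY => ?_⟩
  · have hrow : rowMul (ctP Ξ X) (1 - lamEval Ξ X) = X := by
      change rowMul (rowMul X (1 - lamEval Ξ X)⁻¹) _ = X
      rw [rowMul_rowMul, Matrix.nonsing_inv_mul _ ((Matrix.isUnit_iff_isUnit_det _).mp hX),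
        rowMul_one]
    have hlam : lamEval Ξ (ctP Ξ X) =
        lamEval Ξ X + lamEval Ξ (ctP Ξ X) * lamEval Ξ X := by
      rw [← hΞ.lamEval_rowMul_lamEval, ← lamEval_add]
      rw [rowMul_sub, rowMul_one, sub_eq_iff_eq_add] at hrow
      exact congrArg _ hrow
    have hinv : (1 + lamEval Ξ (ctP Ξ X)) * (1 - lamEval Ξ X) = 1 := by
      rw [add_mul, one_mul, mul_sub, mul_one, sub_eq_of_eq_add hlam, sub_add_cancel]
    refine ⟨IsUnit.of_mul_eq_one _ hinv, ?_⟩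
    change rowMul (ctP Ξ X) (1 + lamEval Ξ (ctP Ξ X))⁻¹ = X
    rw [Matrix.inv_eq_right_inv hinv, hrow]
  · have hrow : rowMul (ctQ Ξ Y) (1 + lamEval Ξ Y) = Y := by
      change rowMul (rowMul Y (1 + lamEval Ξ Y)⁻¹) _ = Y
      rw [rowMul_rowMul, Matrix.nonsing_inv_mul _ ((Matrix.isUnit_iff_isUnit_det _).mp hY),
        rowMul_one]
    have hlam : lamEval Ξ (ctQ Ξ Y) + lamEval Ξ (ctQ Ξ Y) * lamEval Ξ Y =
        lamEval Ξ Y := by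
      rw [← hΞ.lamEval_rowMul_lamEval, ← lamEval_add]
      rw [rowMul_add, rowMul_one] at hrow
      exact congrArg _ hrow
    have hinv : (1 - lamEval Ξ (ctQ Ξ Y)) * (1 + lamEval Ξ Y) = 1 := by
      rw [sub_mul, one_mul, mul_add, mul_one, hlam, add_sub_cancel_right]
    refine ⟨IsUnit.of_mul_eq_one _ hinv, ?_⟩
    change rowMul (ctQ Ξ Y) (1 - lamEval Ξ (ctQ Ξ Y))⁻¹ = Y
    rw [Matrix.inv_eq_right_inv hinv, hrow]
end

section
/- Let A = (A_1,…,A_g) ∈ M_d(ℂ)^g with {A_1,…,A_g} linearly independent, and suppose C ∈ M_d(ℂ) is such that for each 1 ≤ j ≤ g there exists a g×g matrix Ξ_j with A_k (C−I)A_j = Σ_{s=1}^g (Ξ_j)_{k,s} A_s for all 1 ≤ k ≤ g. Set R_j = (C−I)A_j and Ξ = (Ξ_1,…,Ξ_g). Then: (1) the span of {R_1,…,R_g} is an algebra, with R_k R^α = Σ_{s=1}^g (Ξ^α)_{k,s} R_s for every word α; (2) A_k R^α = Σ_{s=1}^g (Ξ^α)_{k,s} A_s for every word α and every k (so the span of {A_1,…,A_g}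 is a right module over that algebra); (3) the tuple Ξ is convexotonic; (4) if R^α = 0 for some word α then Ξ^α = 0, and conversely if Ξ^α = 0 then R_j R^α = 0 for all 1 ≤ j ≤ g. -/
/-- The product of matrices from the tuple `T` along the word `α` (empty word ↦ identity). -/
noncomputable def wordProd {g d : ℕ} (T : Fin g → Matrix (Fin d) (Fin d) ℂ)
    (α : List (Fin g)) : Matrix (Fin d) (Fin d) ℂ :=
  (α.map T).prod

theorem sum_mul_smul_eq {g : ℕ} {M : Type*} [AddCommMonoid M] [Module ℂ M]
    (P Q : Matrix (Fin g) (Fin g) ℂ) (A : Fin g → M) (k : Fin g) :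
    ∑ s, (P * Q) k s • A s = ∑ t, P k t • ∑ s, Q t s • A s := by
  simp only [Matrix.mul_apply, Finset.sum_smul, Finset.smul_sum, mul_smul]
  exact Finset.sum_comm

theorem mul_wordProd_eq_sum {g d : ℕ} {A R : Fin g → Matrix (Fin d) (Fin d) ℂ}
    {Ξ : Fin g → Matrix (Fin g) (Fin g) ℂ}
    (h : ∀ j k, A k * R j = ∑ s, Ξ j k s • A s) (α : List (Fin g)) (k : Fin g) :
    A k * wordProd R α = ∑ s, wordProd Ξ α k s • A s := by
  induction α generalizing k with
  | nil => simp [wordProd, Matrix.one_apply]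
  | cons a β ih =>
    have hR : wordProd R (a :: β) = R a * wordProd R β := by simp [wordProd]
    have hX : wordProd Ξ (a :: β) = Ξ a * wordProd Ξ β := by simp [wordProd]
    rw [hR, hX, sum_mul_smul_eq, ← mul_assoc, h, Finset.sum_mul]
    simp only [smul_mul_assoc, ih]

theorem matrix_ext_of_sum_smul_eq {g : ℕ} {M : Type*} [AddCommGroup M] [Module ℂ M]
    {A : Fin g → M} (hind : LinearIndependent ℂ A) {P Q : Matrix (Fin g) (Fin g) ℂ}
    (h : ∀ k, ∑ s, P k s • A s = ∑ s, Q k s • A s) : P = Q := by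
  ext k s
  refine sub_eq_zero.mp (Fintype.linearIndependent_iff.mp hind (fun s => P k s - Q k s) ?_ s)
  simp only [sub_smul, Finset.sum_sub_distrib, h, sub_self]

theorem convexotonic_of_mul_eq_sum {g d : ℕ} {A R : Fin g → Matrix (Fin d) (Fin d) ℂ}
    {Ξ : Fin g → Matrix (Fin g) (Fin g) ℂ} (hind : LinearIndependent ℂ A)
    (hA : ∀ j k, A k * R j = ∑ s, Ξ j k s • A s)
    (hR : ∀ j k, R k * R j = ∑ s, Ξ j k s • R s) : Convexotonic Ξ := by
  intro j k
  refine matrix_ext_of_sum_smul_eq hind fun l => ?_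
  calc ∑ s, (Ξ k * Ξ j) l s • A s = A l * (R k * R j) := by
        rw [sum_mul_smul_eq, ← mul_assoc, hA, Finset.sum_mul]
        simp only [smul_mul_assoc, hA]
    _ = ∑ s, (∑ t, Ξ j k t • Ξ t) l s • A s := by
        simp only [hR, Finset.mul_sum, mul_smul_comm, hA, Matrix.sum_apply, Matrix.smul_apply,
          Finset.sum_smul, Finset.smul_sum, smul_assoc]
        exact Finset.sum_comm

/-- Suppose `{A_1,…,A_g}` is linearly independent and `C` is such that
`A_k (C−I) A_j = Σ_s (Ξ_j)_{k,s} A_s` for all `j,k`.  With `R_j = (C−I)A_j`: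
(1) the span of the `R_j` is an algebra, with `R_k R^α = Σ_s (Ξ^α)_{k,s} R_s`;
(2) `A_k R^α = Σ_s (Ξ^α)_{k,s} A_s` (the span of the `A_j` is a right module over that algebra);
(3) `Ξ` is convexotonic;
(4) `R^α = 0` implies `Ξ^α = 0`, and conversely `Ξ^α = 0` implies `R_j R^α = 0` for all `j`. -/
theorem lurking_algebra {g d : ℕ}
    (A : Fin g → Matrix (Fin d) (Fin d) ℂ)
    (C : Matrix (Fin d) (Fin d) ℂ)
    (Ξ : Fin g → Matrix (Fin g) (Fin g) ℂ)
    (hind : LinearIndependent ℂ A)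
    (hΞ : ∀ j k : Fin g, A k * ((C - 1) * A j) = ∑ s : Fin g, (Ξ j) k s • A s) :
    (∀ (α : List (Fin g)) (k : Fin g),
      ((C - 1) * A k) * wordProd (fun j => (C - 1) * A j) α =
        ∑ s : Fin g, (wordProd Ξ α) k s • ((C - 1) * A s)) ∧
    (∀ (α : List (Fin g)) (k : Fin g),
      A k * wordProd (fun j => (C - 1) * A j) α = ∑ s : Fin g, (wordProd Ξ α) k s • A s) ∧
    Convexotonic Ξ ∧
    (∀ α : List (Fin g),
      wordProd (fun j => (C - 1) * A j) α = 0 → wordProd Ξ α = 0) ∧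
    (∀ α : List (Fin g), wordProd Ξ α = 0 → ∀ j : Fin g,
      ((C - 1) * A j) * wordProd (fun i => (C - 1) * A i) α = 0) := by
  have hR : ∀ j k : Fin g, (C - 1) * A k * ((C - 1) * A j) =
      ∑ s, (Ξ j) k s • ((C - 1) * A s) := fun j k => by
    simp only [mul_assoc (C - 1) (A k), hΞ, Finset.mul_sum, mul_smul_comm]
  refine ⟨mul_wordProd_eq_sum hR, mul_wordProd_eq_sum hΞ,
    convexotonic_of_mul_eq_sum hind hΞ hR, fun α hα => ?_, fun α hα j => ?_⟩
  · refine matrix_ext_of_sum_smul_eq hind fun k => ?_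
    rw [← mul_wordProd_eq_sum hΞ, hα]
    simp
  · rw [mul_wordProd_eq_sum (A := fun i => (C - 1) * A i) hR, hα]
    simp
end

section
/- If 0 < C < 2 and T is a square complex matrix with C·I − (T+T^*) positive semidefinite, then I − T is invertible. Moreover, for every M > 0 and t > 0 there exist C with 1 < C < 2 and real numbers ε, δ with t > ε > δ > 0 such that for every square complex matrix T with C·I − (T+T^*) positive semidefinite and ‖T‖ < M, one has ‖T(I−T)^{-1} − ε·I‖ ≤ 1 + δ. -/
open scoped Matrix ComplexOrder

/-- The operator (ℓ²→ℓ²) norm of a square complex matrix. -/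
noncomputable def opN {m : Type*} [Fintype m] [DecidableEq m] (T : Matrix m m ℂ) : ℝ :=
  ‖Matrix.toEuclideanCLM (𝕜 := ℂ) T‖

/-- A positive semidefinite bound on the Hermitian part bounds the real part of the quadratic
form. -/
theorem two_mul_re_inner_toEuclideanCLM_le {m : Type*} [Fintype m] [DecidableEq m] {c : ℝ}
    {T : Matrix m m ℂ} (hT : ((c : ℂ) • (1 : Matrix m m ℂ) - (T + Tᴴ)).PosSemidef)
    (x : EuclideanSpace ℂ m) :
    2 * (inner ℂ x (Matrix.toEuclideanCLM (𝕜 := ℂ) T x)).re ≤ c * ‖x‖ ^ 2 := by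
  have h := (Matrix.posSemidef_iff_dotProduct_mulVec.1 hT).2 x.ofLp
  have key : star x.ofLp ⬝ᵥ (((c : ℂ) • (1 : Matrix m m ℂ) - (T + Tᴴ)) *ᵥ x.ofLp) =
      inner ℂ x (Matrix.toEuclideanCLM (𝕜 := ℂ) ((c : ℂ) • (1 : Matrix m m ℂ) - (T + Tᴴ)) x) := by
    rw [EuclideanSpace.inner_eq_star_dotProduct, Matrix.ofLp_toEuclideanCLM, dotProduct_comm]
  rw [key, ← Matrix.star_eq_conjTranspose] at h
  simp only [map_sub, map_add, map_smul, map_one, map_star, ContinuousLinearMap.star_eq_adjoint,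
    sub_apply, add_apply, smul_apply,
    one_apply_eq_self, inner_sub_right, inner_add_right, inner_smul_right,
    ContinuousLinearMap.adjoint_inner_right, inner_self_eq_norm_sq_to_K] at h
  have h' := (Complex.le_def.1 h).1
  have hs : (inner ℂ (Matrix.toEuclideanCLM (𝕜 := ℂ) T x) x).re =
      (inner ℂ x (Matrix.toEuclideanCLM (𝕜 := ℂ) T x)).re := inner_re_symm (𝕜 := ℂ) _ _
  have hn : ((c : ℂ) * ((‖x‖ : ℂ)) ^ 2).re = c * ‖x‖ ^ 2 := by norm_cast
  simp only [Complex.sub_re, Complex.add_re, Complex.zero_re, Complex.coe_algebraMap, hn, hs] at h'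
  linarith

/-- If the Hermitian part of `2T` is at most `c < 2` then `1 - T` is invertible. -/
theorem isUnit_one_sub_of_posSemidef {m : Type*} [Fintype m] [DecidableEq m] {c : ℝ}
    (hc : c < 2) {T : Matrix m m ℂ}
    (hT : ((c : ℂ) • (1 : Matrix m m ℂ) - (T + Tᴴ)).PosSemidef) : IsUnit (1 - T) := by
  rw [← Matrix.mulVec_injective_iff_isUnit, ← Matrix.coe_mulVecLin, ← LinearMap.ker_eq_bot,
    LinearMap.ker_eq_bot']
  intro v hv
  rw [Matrix.mulVecLin_apply, Matrix.sub_mulVec, Matrix.one_mulVec, sub_eq_zero] at hv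
  set x : EuclideanSpace ℂ m := WithLp.toLp 2 v with hx
  have hfix : Matrix.toEuclideanCLM (𝕜 := ℂ) T x = x := by
    rw [hx, Matrix.toEuclideanCLM_toLp, ← hv]
  have h := two_mul_re_inner_toEuclideanCLM_le hT x
  have hn : (inner ℂ x x).re = ‖x‖ ^ 2 := inner_self_eq_norm_sq (𝕜 := ℂ) x
  rw [hfix, hn] at h
  have hx0 : ‖x‖ = 0 := by
    by_contra hne
    have : 0 < ‖x‖ ^ 2 := by positivity
    nlinarith
  simpa [hx] using hx0

/-- A sufficient numerical condition for the bound `‖T (1 - T)⁻¹ - ε‖ ≤ 1 + δ`. -/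
theorem opN_mul_inv_sub_smul_le {m : Type*} [Fintype m] [DecidableEq m] {c M ε δ : ℝ}
    (hc : c < 2) (hδ : 0 ≤ δ) (hδε : δ ≤ ε)
    (hnum : 1 + ((1 + ε) ^ 2 - (1 + δ) ^ 2) * (1 + M) ^ 2 ≤ (1 + ε) * (2 - c))
    {T : Matrix m m ℂ} (hT : ((c : ℂ) • (1 : Matrix m m ℂ) - (T + Tᴴ)).PosSemidef)
    (hM : opN T ≤ M) :
    opN (T * (1 - T)⁻¹ - (ε : ℂ) • (1 : Matrix m m ℂ)) ≤ 1 + δ := by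
  have hu := (Matrix.isUnit_iff_isUnit_det _).1 (isUnit_one_sub_of_posSemidef hc hT)
  refine ContinuousLinearMap.opNorm_le_bound _ (by linarith) fun y => ?_
  set x := Matrix.toEuclideanCLM (𝕜 := ℂ) (1 - T)⁻¹ y with hx
  have hy : x - Matrix.toEuclideanCLM (𝕜 := ℂ) T x = y := by
    have h := congrArg (fun S => Matrix.toEuclideanCLM (𝕜 := ℂ) S y) (Matrix.mul_nonsing_inv _ hu)
    simpa [map_mul, map_sub] using h
  have hval : Matrix.toEuclideanCLM (𝕜 := ℂ) (T * (1 - T)⁻¹ - (ε : ℂ) • (1 : Matrix m m ℂ)) y =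
      x - ((1 + ε : ℝ) : ℂ) • y := by
    have h : Matrix.toEuclideanCLM (𝕜 := ℂ) T x = x - y := by rw [← hy]; abel
    simp only [map_sub, map_mul, map_smul, map_one, sub_apply,
      mul_apply_eq_comp, smul_apply,
      one_apply_eq_self, ← hx, h]
    push_cast
    module
  rw [hval]
  have hyn : ‖y‖ ≤ (1 + M) * ‖x‖ := by
    have h1 := (Matrix.toEuclideanCLM (𝕜 := ℂ) T).le_of_opNorm_le hM x
    have h2 := norm_sub_le x (Matrix.toEuclideanCLM (𝕜 := ℂ) T x)
    rw [hy] at h2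
    linarith
  have hin : (2 - c) * ‖x‖ ^ 2 ≤ 2 * (inner ℂ x y).re := by
    have h := two_mul_re_inner_toEuclideanCLM_le hT x
    have hn : (inner ℂ x x).re = ‖x‖ ^ 2 := inner_self_eq_norm_sq (𝕜 := ℂ) x
    rw [← hy, inner_sub_right, Complex.sub_re, hn]
    linarith
  have hexp : ‖x - ((1 + ε : ℝ) : ℂ) • y‖ ^ 2 =
      ‖x‖ ^ 2 - 2 * ((1 + ε) * (inner ℂ x y).re) + (1 + ε) ^ 2 * ‖y‖ ^ 2 := by
    rw [norm_sub_sq (𝕜 := ℂ), inner_smul_right, norm_smul, mul_pow, Complex.norm_real,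
      Real.norm_eq_abs, sq_abs]
    simp only [RCLike.re_eq_complex_re, Complex.re_ofReal_mul]
  refine (sq_le_sq₀ (norm_nonneg _) (mul_nonneg (by linarith) (norm_nonneg y))).1 ?_
  have hy2 : ‖y‖ ^ 2 ≤ (1 + M) ^ 2 * ‖x‖ ^ 2 := by
    rw [← mul_pow]; gcongr
  have hD : 0 ≤ (1 + ε) ^ 2 - (1 + δ) ^ 2 := by nlinarith
  have h1 := mul_le_mul_of_nonneg_left hy2 hD
  have h2 := mul_le_mul_of_nonneg_left hin (show 0 ≤ 1 + ε by linarith)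
  have h3 := mul_le_mul_of_nonneg_right hnum (sq_nonneg ‖x‖)
  rw [hexp]
  linarith

/-- If `0 < C < 2` and `C·I − (T + T^*) ⪰ 0` then `I − T` is invertible.  Moreover, for every
`M > 0` and `t > 0` there are `1 < C < 2` and `t > ε > δ > 0` such that
`‖T(I−T)⁻¹ − ε·I‖ ≤ 1 + δ` whenever `C·I − (T + T^*) ⪰ 0` and `‖T‖ < M`. -/
theorem frakF_invertibility_and_phi_bound :
    (∀ c : ℝ, 0 < c → c < 2 → ∀ (n : ℕ) (T : Matrix (Fin n) (Fin n) ℂ),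
      ((c : ℂ) • (1 : Matrix (Fin n) (Fin n) ℂ) - (T + Tᴴ)).PosSemidef →
      IsUnit (1 - T)) ∧
    (∀ M t : ℝ, 0 < M → 0 < t →
      ∃ c : ℝ, 1 < c ∧ c < 2 ∧ ∃ ε δ : ℝ, 0 < δ ∧ δ < ε ∧ ε < t ∧
        ∀ (n : ℕ) (T : Matrix (Fin n) (Fin n) ℂ),
          ((c : ℂ) • (1 : Matrix (Fin n) (Fin n) ℂ) - (T + Tᴴ)).PosSemidef →
          opN T < M →
          opN (T * (1 - T)⁻¹ - (ε : ℂ) • (1 : Matrix (Fin n) (Fin n) ℂ)) ≤ 1 + δ) := by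
  refine ⟨fun c _ hc n T hT => isUnit_one_sub_of_posSemidef hc hT, fun M t hM ht => ?_⟩
  obtain ⟨ε, hε, hεt, hε1⟩ : ∃ ε : ℝ, 0 < ε ∧ ε < t ∧ ε < 1 := by
    obtain ⟨ε, h0, h⟩ := exists_between (lt_min ht one_pos)
    exact ⟨ε, h0, h.trans_le (min_le_left _ _), h.trans_le (min_le_right _ _)⟩
  set s : ℝ := 1 / (16 * (1 + M) ^ 2) with hs
  have hs0 : 0 < s := by positivity
  have hs1 : s < 1 := by
    rw [hs, div_lt_one (by positivity)]
    nlinarith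
  have hsM : s * (1 + M) ^ 2 = 1 / 16 := by
    rw [hs]; field_simp
  refine ⟨1 + ε / 4, by linarith, by linarith, ε, ε * (1 - s), by nlinarith, by nlinarith, hεt,
    fun n T hT hTM => opN_mul_inv_sub_smul_le (by linarith) (by nlinarith) (by nlinarith) ?_ hT
      hTM.le⟩
  have hfac : ((1 + ε) ^ 2 - (1 + ε * (1 - s)) ^ 2) * (1 + M) ^ 2 =
      ε * (2 + ε + ε * (1 - s)) * (s * (1 + M) ^ 2) := by ring
  rw [hfac, hsM]
  nlinarith [mul_pos hε hs0, mul_pos (mul_pos hε hε) hs0, mul_pos hε (sub_pos.2 hε1)]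
end

section
/- For each M > 0 and ρ > 0 there exists C_0 with 1 < C_0 < 2 such that for each C with 1 < C < C_0 there exist real numbers ε, δ with ρ > ε > δ > 0 such that for each η > 0 there is a polynomial q ∈ ℂ[z] such that for every square complex matrix T with C·I − (T+T^*) positive semidefinite and ‖T‖ < M: (1) ‖T(I−T)^{-1} − ε·I‖ < 1 + δ, and (2) ‖q(T) − T(I−T)^{-1}‖ < η, where q(T) is the usual polynomial evaluation at the matrix T. -/
open scoped Matrix ComplexOrder

open scoped InnerProductSpace

section HilbertSpace

variable {E : Type*} [NormedAddCommGroup E] [InnerProductSpace ℂ E]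

theorem norm_sub_smul_sub_le {M c ε d : ℝ} {x v : E} (hd : 0 ≤ d) (hdε : d ≤ 1 + ε)
    (hεd : ε + ε ^ 2 ≤ d ^ 2)
    (hpos : 0 ≤ (d ^ 2 - ε ^ 2) - c * (d ^ 2 - ε - ε ^ 2) - ((1 + ε) ^ 2 - d ^ 2) * M ^ 2)
    (hre : 2 * (⟪x, v⟫_ℂ).re ≤ c * ‖x‖ ^ 2) (hv : ‖v‖ ≤ M * ‖x‖) :
    ‖v - (ε : ℂ) • (x - v)‖ ≤ d * ‖x - v‖ := by
  have hsplit : v - (ε : ℂ) • (x - v) = ((1 : ℂ) + ε) • v - (ε : ℂ) • x := by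
    rw [smul_sub, add_smul, one_smul]; abel
  have h1 : ‖v - (ε : ℂ) • (x - v)‖ ^ 2 =
      (1 + ε) ^ 2 * ‖v‖ ^ 2 - 2 * (ε * (1 + ε)) * (⟪x, v⟫_ℂ).re + ε ^ 2 * ‖x‖ ^ 2 := by
    have hone : ((1 : ℂ) + ε) = ((1 + ε : ℝ) : ℂ) := by push_cast; rfl
    have hsymm : (⟪v, x⟫_ℂ).re = (⟪x, v⟫_ℂ).re := inner_re_symm (𝕜 := ℂ) v x
    rw [hsplit, @norm_sub_sq ℂ, hone, norm_smul, norm_smul, mul_pow, mul_pow,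
      Complex.norm_real, Complex.norm_real, Real.norm_eq_abs, Real.norm_eq_abs, sq_abs, sq_abs,
      inner_smul_left, inner_smul_right, Complex.conj_ofReal]
    simp only [RCLike.re_to_complex, Complex.re_ofReal_mul, hsymm]
    ring
  have h2 : ‖x - v‖ ^ 2 = ‖x‖ ^ 2 - 2 * (⟪x, v⟫_ℂ).re + ‖v‖ ^ 2 := @norm_sub_sq ℂ _ _ _ _ x v
  have hv2 : ‖v‖ ^ 2 ≤ M ^ 2 * ‖x‖ ^ 2 := by
    rw [← mul_pow]; gcongr
  have hd2 : d ^ 2 ≤ (1 + ε) ^ 2 := by gcongr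
  refine le_of_sq_le_sq ?_ (by positivity)
  rw [mul_pow, h1, h2]
  nlinarith [mul_le_mul_of_nonneg_left hv2 (sub_nonneg.2 hd2),
    mul_le_mul_of_nonneg_left hre (sub_nonneg.2 hεd), mul_nonneg hpos (sq_nonneg ‖x‖)]

theorem norm_sub_smul_sq_le {a L t : ℝ} {x w : E} (ht : 0 ≤ t)
    (hre : a * ‖x‖ ^ 2 ≤ (⟪x, w⟫_ℂ).re) (hw : ‖w‖ ≤ L * ‖x‖) :
    ‖x - (t : ℂ) • w‖ ^ 2 ≤ (1 - 2 * t * a + t ^ 2 * L ^ 2) * ‖x‖ ^ 2 := by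
  have hw2 : ‖w‖ ^ 2 ≤ L ^ 2 * ‖x‖ ^ 2 := by
    rw [← mul_pow]; gcongr
  rw [@norm_sub_sq ℂ, norm_smul, mul_pow, Complex.norm_real, Real.norm_eq_abs, sq_abs,
    inner_smul_right]
  simp only [RCLike.re_to_complex, Complex.re_ofReal_mul]
  nlinarith [mul_le_mul_of_nonneg_left hw2 (sq_nonneg t), mul_le_mul_of_nonneg_left hre ht]

theorem mul_norm_le_of_le_re_inner {a : ℝ} {x w : E}
    (hre : a * ‖x‖ ^ 2 ≤ (⟪x, w⟫_ℂ).re) : a * ‖x‖ ≤ ‖w‖ := by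
  have h : (⟪x, w⟫_ℂ).re ≤ ‖x‖ * ‖w‖ := re_inner_le_norm (𝕜 := ℂ) x w
  rcases (norm_nonneg x).eq_or_lt with h0 | h0
  · simp [← h0]
  · exact le_of_mul_le_mul_left (by nlinarith) h0

/-- The Neumann series for the inverse of a strictly accretive operator `S`, with an explicit
error bound. -/
theorem norm_neumann_sum_sub_le {S Q : E →L[ℂ] E} {a L r : ℝ} (ha : 0 < a) (hL : 0 < L)
    (hr : 0 ≤ r) (hr2 : r ^ 2 = 1 - a ^ 2 / L ^ 2)
    (hre : ∀ x, a * ‖x‖ ^ 2 ≤ (⟪x, S x⟫_ℂ).re) (hS : ‖S‖ ≤ L) (hSQ : S * Q = 1) (N : ℕ) :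
    ‖((a / L ^ 2 : ℝ) : ℂ) • ∑ k ∈ Finset.range N, (1 - ((a / L ^ 2 : ℝ) : ℂ) • S) ^ k - Q‖
      ≤ r ^ N * a⁻¹ := by
  set t : ℝ := a / L ^ 2 with ht
  set B : E →L[ℂ] E := 1 - (t : ℂ) • S with hB
  have hBnorm : ‖B‖ ≤ r := by
    refine B.opNorm_le_bound hr fun x => le_of_sq_le_sq ?_ (by positivity)
    have h := norm_sub_smul_sq_le (t := t) (by positivity) (hre x) (S.le_of_opNorm_le hS x)
    have hcoef : 1 - 2 * t * a + t ^ 2 * L ^ 2 = 1 - a ^ 2 / L ^ 2 := by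
      rw [ht]; field_simp; ring
    rw [mul_pow, hr2, ← hcoef]
    exact h
  have hQnorm : ‖Q‖ ≤ a⁻¹ := by
    refine Q.opNorm_le_bound (by positivity) fun y => ?_
    have h := mul_norm_le_of_le_re_inner (hre (Q y))
    rw [← mul_apply_eq_comp, hSQ, one_apply_eq_self] at h
    rw [inv_mul_eq_div, le_div_iff₀' ha]
    exact h
  have htS : (t : ℂ) • S = 1 - B := by rw [hB]; abel
  have key : (t : ℂ) • ∑ k ∈ Finset.range N, B ^ k - Q = -(B ^ N * Q) := by
    have h1 : (∑ k ∈ Finset.range N, B ^ k) * (1 - B) = 1 - B ^ N := geom_sum_mul_neg B N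
    have h2 : (t : ℂ) • ∑ k ∈ Finset.range N, B ^ k = (1 - B ^ N) * Q := by
      rw [← h1, ← htS, mul_assoc, smul_mul_assoc, hSQ, mul_smul_comm, mul_one]
    rw [h2, sub_mul, one_mul]; abel
  rw [key, norm_neg]
  have hpow : ‖B ^ N‖ ≤ r ^ N := by
    clear key
    induction N with
    | zero =>
      rw [pow_zero, pow_zero]
      exact ContinuousLinearMap.norm_id_le
    | succ k ih =>
      rw [pow_succ, pow_succ]
      exact (norm_mul_le _ _).trans (by gcongr)
  exact (norm_mul_le _ _).trans (by gcongr)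

end HilbertSpace

theorem Matrix.re_inner_toEuclideanCLM_le {n : Type*} [Fintype n] [DecidableEq n] {c : ℝ}
    {T : Matrix n n ℂ} (hT : ((c : ℂ) • (1 : Matrix n n ℂ) - (T + Tᴴ)).PosSemidef)
    (x : EuclideanSpace ℂ n) :
    2 * (⟪x, Matrix.toEuclideanCLM (𝕜 := ℂ) T x⟫_ℂ).re ≤ c * ‖x‖ ^ 2 := by
  set A := Matrix.toEuclideanCLM (𝕜 := ℂ) T with hA
  have hpos : 0 ≤ (⟪x, Matrix.toEuclideanCLM (𝕜 := ℂ)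
      ((c : ℂ) • (1 : Matrix n n ℂ) - (T + Tᴴ)) x⟫_ℂ).re := by
    have h := hT.re_dotProduct_nonneg x.ofLp
    rwa [EuclideanSpace.inner_eq_star_dotProduct, Matrix.ofLp_toEuclideanCLM,
      dotProduct_comm]
  have hmap : Matrix.toEuclideanCLM (𝕜 := ℂ) ((c : ℂ) • (1 : Matrix n n ℂ) - (T + Tᴴ)) =
      (c : ℂ) • 1 - (A + star A) := by
    rw [map_sub, map_add, map_smul, map_one, ← Matrix.star_eq_conjTranspose, map_star]
  have hadj : (⟪x, star A x⟫_ℂ).re = (⟪x, A x⟫_ℂ).re := by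
    rw [ContinuousLinearMap.star_eq_adjoint, ContinuousLinearMap.adjoint_inner_right]
    exact inner_re_symm (𝕜 := ℂ) _ _
  have hself : (⟪x, x⟫_ℂ).re = ‖x‖ ^ 2 := inner_self_eq_norm_sq (𝕜 := ℂ) x
  rw [hmap] at hpos
  simp only [_root_.sub_apply, _root_.add_apply,
    _root_.smul_apply, one_apply_eq_self, inner_sub_right,
    inner_add_right, inner_smul_right, Complex.sub_re, Complex.add_re, Complex.re_ofReal_mul,
    hadj, hself] at hpos
  linarith

/-- A real-part bound below `1` makes `1 - T` invertible. -/
theorem Matrix.one_sub_mul_inv_of_re_inner_le {n : Type*} [Fintype n] [DecidableEq n] {c : ℝ}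
    {T : Matrix n n ℂ} (hc : c < 2)
    (hT : ∀ x, 2 * (⟪x, Matrix.toEuclideanCLM (𝕜 := ℂ) T x⟫_ℂ).re ≤ c * ‖x‖ ^ 2) :
    (1 - T) * (1 - T)⁻¹ = 1 := by
  have hunit : IsUnit (1 - T) := by
    rw [← Matrix.mulVec_injective_iff_isUnit]
    refine (injective_iff_map_eq_zero (1 - T).mulVecLin).2 fun v hv => ?_
    have hv' : v - T *ᵥ v = 0 := by simpa [Matrix.sub_mulVec] using hv
    have hTv : Matrix.toEuclideanCLM (𝕜 := ℂ) T (WithLp.toLp 2 v) = WithLp.toLp 2 v := by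
      rw [Matrix.toEuclideanCLM_toLp, ← sub_eq_zero.1 hv']
    have h := hT (WithLp.toLp 2 v)
    have hself : (⟪WithLp.toLp 2 v, WithLp.toLp 2 v⟫_ℂ).re = ‖WithLp.toLp 2 v‖ ^ 2 :=
      inner_self_eq_norm_sq (𝕜 := ℂ) _
    rw [hTv, hself] at h
    have h0 : ‖WithLp.toLp 2 v‖ ^ 2 = 0 := by nlinarith [sq_nonneg ‖WithLp.toLp 2 v‖]
    simpa using h0
  exact Matrix.mul_nonsing_inv _ ((Matrix.isUnit_iff_isUnit_det _).1 hunit)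

theorem exists_shift_parameters {M ρ c : ℝ} (hc1 : 1 < c) (hc : c < 1 + ρ / (1 + ρ))
    (hρ : 0 < ρ) :
    ∃ ε δ : ℝ, 0 < δ ∧ δ < ε ∧ ε < ρ ∧ ε + ε ^ 2 ≤ (1 + δ) ^ 2 ∧
      0 ≤ ((1 + δ) ^ 2 - ε ^ 2) - c * ((1 + δ) ^ 2 - ε - ε ^ 2)
        - ((1 + ε) ^ 2 - (1 + δ) ^ 2) * M ^ 2 := by
  have hc' : (c - 1) * (1 + ρ) < ρ := by
    rw [← lt_div_iff₀ (by positivity)]; linarith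
  have hc2 : 0 < 2 - c := by nlinarith
  obtain ⟨ε, hε, hερ⟩ : ∃ ε, (c - 1) / (2 - c) < ε ∧ ε < ρ :=
    exists_between (by rw [div_lt_iff₀ hc2]; linarith)
  have hε0 : 0 < ε := (div_pos (by linarith) hc2).trans hε
  rw [div_lt_iff₀ hc2] at hε
  have h1 : ∀ᶠ δ in nhdsWithin ε (Set.Iio ε), ε + ε ^ 2 < (1 + δ) ^ 2 := by
    refine nhdsWithin_le_nhds (ContinuousAt.eventually_lt (by fun_prop) (by fun_prop) ?_)
    nlinarith
  have h2 : ∀ᶠ δ in nhdsWithin ε (Set.Iio ε), 0 < ((1 + δ) ^ 2 - ε ^ 2)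
      - c * ((1 + δ) ^ 2 - ε - ε ^ 2) - ((1 + ε) ^ 2 - (1 + δ) ^ 2) * M ^ 2 := by
    refine nhdsWithin_le_nhds (ContinuousAt.eventually_lt (by fun_prop) (by fun_prop) ?_)
    nlinarith
  have h3 : ∀ᶠ δ in nhdsWithin ε (Set.Iio ε), 0 < δ :=
    nhdsWithin_le_nhds (lt_mem_nhds hε0)
  obtain ⟨δ, ⟨⟨h1, h2⟩, h3⟩, h4⟩ := (((h1.and h2).and h3).and self_mem_nhdsWithin).exists
  exact ⟨ε, δ, h3, h4, hερ, h1.le, h2.le⟩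

/-- For each `M > 0` and `ρ > 0` there is `1 < C₀ < 2` such that for each `1 < C < C₀` there
are `ρ > ε > δ > 0` such that for each `η > 0` there is a polynomial `q` with:
for every square complex `T` with `C·I − (T+T^*) ⪰ 0` and `‖T‖ < M`,
`‖T(I−T)⁻¹ − ε·I‖ < 1 + δ` and `‖q(T) − T(I−T)⁻¹‖ < η`. -/
theorem uniform_polynomial_approximation_of_phi :
    ∀ M ρ : ℝ, 0 < M → 0 < ρ →
      ∃ C₀ : ℝ, 1 < C₀ ∧ C₀ < 2 ∧
        ∀ c : ℝ, 1 < c → c < C₀ →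
          ∃ ε δ : ℝ, 0 < δ ∧ δ < ε ∧ ε < ρ ∧
            ∀ η : ℝ, 0 < η →
              ∃ q : Polynomial ℂ,
                ∀ (n : ℕ) (T : Matrix (Fin n) (Fin n) ℂ),
                  ((c : ℂ) • (1 : Matrix (Fin n) (Fin n) ℂ) - (T + Tᴴ)).PosSemidef →
                  opN T < M →
                  opN (T * (1 - T)⁻¹ - (ε : ℂ) • (1 : Matrix (Fin n) (Fin n) ℂ)) < 1 + δ ∧
                  opN ((Polynomial.aeval T) q - T * (1 - T)⁻¹) < η := by
  intro M ρ hM hρ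
  have hρ1 : ρ / (1 + ρ) < 1 := by rw [div_lt_one (by positivity)]; linarith
  refine ⟨1 + ρ / (1 + ρ), by linarith [div_pos hρ (by linarith : 0 < 1 + ρ)], by linarith,
    fun c hc1 hc => ?_⟩
  have hc2 : c < 2 := by linarith
  obtain ⟨ε, δ, hδ, hδε, hερ, hεd, hpos⟩ := exists_shift_parameters (M := M) hc1 hc hρ
  refine ⟨ε, (δ + ε) / 2, by linarith, by linarith, hερ, fun η hη => ?_⟩
  set a : ℝ := 1 - c / 2 with ha_def
  set L : ℝ := 1 + M
  have ha : 0 < a := by rw [ha_def]; linarith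
  have hL : 0 < L := by positivity
  have hquot : a ^ 2 / L ^ 2 ≤ 1 := by
    rw [div_le_one (by positivity)]
    gcongr
    linarith
  set r : ℝ := √(1 - a ^ 2 / L ^ 2)
  have hr2 : r ^ 2 = 1 - a ^ 2 / L ^ 2 := Real.sq_sqrt (by linarith)
  have hr0 : 0 ≤ r := Real.sqrt_nonneg _
  have hr1 : r < 1 := by
    have : 0 < a ^ 2 / L ^ 2 := by positivity
    nlinarith
  obtain ⟨N, hN⟩ := exists_pow_lt_of_lt_one (mul_pos hη ha) hr1
  refine ⟨Polynomial.C ((a / L ^ 2 : ℝ) : ℂ) * ∑ k ∈ Finset.range N,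
    (1 - Polynomial.C ((a / L ^ 2 : ℝ) : ℂ) * (1 - Polynomial.X)) ^ k - 1, fun n T hT hTM => ?_⟩
  have hre := Matrix.re_inner_toEuclideanCLM_le hT
  have hinv := Matrix.one_sub_mul_inv_of_re_inner_le hc2 hre
  have hTinv : T * (1 - T)⁻¹ = (1 - T)⁻¹ - 1 := by
    rw [sub_mul, one_mul] at hinv
    exact eq_sub_of_add_eq' (sub_eq_iff_eq_add.1 hinv).symm
  set A := Matrix.toEuclideanCLM (𝕜 := ℂ) T with hA
  set Q := Matrix.toEuclideanCLM (𝕜 := ℂ) (1 - T)⁻¹ with hQ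
  have hAQ : (1 - A) * Q = 1 := by
    rw [hA, hQ, ← map_one (Matrix.toEuclideanCLM (𝕜 := ℂ)), ← map_sub, ← map_mul, hinv]
  have hAM : ‖A‖ ≤ M := hTM.le
  have hone : ‖(1 : EuclideanSpace ℂ (Fin n) →L[ℂ] EuclideanSpace ℂ (Fin n))‖ ≤ 1 :=
    ContinuousLinearMap.norm_id_le
  constructor
  · have hle : ‖A * Q - (ε : ℂ) • 1‖ ≤ 1 + δ := by
      refine ContinuousLinearMap.opNorm_le_bound _ (by linarith) fun y => ?_
      have hy : y = Q y - A (Q y) := by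
        simpa using (DFunLike.congr_fun hAQ y).symm
      have h := norm_sub_smul_sub_le (by linarith) (by linarith) hεd hpos (hre (Q y))
        (A.le_of_opNorm_le hAM (Q y))
      rwa [← hy] at h
    rw [opN, map_sub, map_mul, map_smul, map_one]
    exact hle.trans_lt (by linarith)
  · have hreS : ∀ x, a * ‖x‖ ^ 2 ≤ (⟪x, (1 - A) x⟫_ℂ).re := fun x => by
      have hself : (⟪x, x⟫_ℂ).re = ‖x‖ ^ 2 := inner_self_eq_norm_sq (𝕜 := ℂ) x
      rw [_root_.sub_apply, one_apply_eq_self, inner_sub_right,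
        Complex.sub_re, hself, ha_def]
      linarith [hre x]
    have h := norm_neumann_sum_sub_le ha hL hr0 hr2 hreS
      ((norm_sub_le _ _).trans (add_le_add hone hAM)) hAQ N
    rw [opN, hTinv]
    simp only [map_sub, map_mul, map_sum, map_pow, map_one, Polynomial.aeval_X,
      Polynomial.aeval_C, Algebra.algebraMap_eq_smul_one, smul_mul_assoc, one_mul, map_smul,
      sub_sub_sub_cancel_right]
    refine h.trans_lt ?_
    rwa [← div_eq_mul_inv, div_lt_iff₀ ha]
end

section
/- For each M > 0 and each C with 1 < C < 2 there exist polynomials s_1, s_2 ∈ ℂ[z] such that for every square complex matrix T: if I − (T+T^*) is positive semidefinite and ‖T‖ < M, then ‖s_1(T)‖ < 1 and ‖s_2(T)‖ < 1; and conversely, if ‖s_1(T)‖ < 1 and ‖s_2(T)‖ < 1, then C·I − (T+T^*) is positive semidefinite and ‖T‖ < M. (Equivalently, with s = s_1 ⊕ s_2 a 2×2 diagonal matrix polynomial, F_{1,M} ⊆ {T : ‖s(T)‖ < 1} ⊆ F_{C,M}.) -/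
open scoped Matrix ComplexOrder

open Matrix in
theorem posSemidef_smul_one_sub_add_conjTranspose_iff {m : Type*} [Fintype m] [DecidableEq m]
    (k : ℝ) (T : Matrix m m ℂ) :
    ((k : ℂ) • (1 : Matrix m m ℂ) - (T + Tᴴ)).PosSemidef ↔
      ∀ x : EuclideanSpace ℂ m,
        2 * (inner ℂ (toEuclideanCLM (𝕜 := ℂ) T x) x).re ≤ k * ‖x‖ ^ 2 := by
  rw [← isPositive_toEuclideanLin_iff, ← coe_toEuclideanCLM_eq_toEuclideanLin,
    ContinuousLinearMap.isPositive_toLinearMap_iff, ContinuousLinearMap.isPositive_def']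
  have hsa : IsSelfAdjoint ((k : ℂ) • (1 : Matrix m m ℂ) - (T + Tᴴ)) := by
    refine IsSelfAdjoint.sub ?_ (IsSelfAdjoint.add_star_self T)
    exact IsSelfAdjoint.smul (Complex.conj_ofReal k) (.one _)
  refine (and_iff_right (hsa.map _)).trans (forall_congr' fun x => ?_)
  have key : (toEuclideanCLM (𝕜 := ℂ) ((k : ℂ) • (1 : Matrix m m ℂ) - (T + Tᴴ))).reApplyInnerSelf x
      = k * ‖x‖ ^ 2 - 2 * (inner ℂ (toEuclideanCLM (𝕜 := ℂ) T x) x).re := by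
    rw [ContinuousLinearMap.reApplyInnerSelf_apply, ← star_eq_conjTranspose, map_sub, map_add,
      map_smul, map_star, map_one, ContinuousLinearMap.star_eq_adjoint]
    simp only [_root_.sub_apply, _root_.add_apply,
      _root_.smul_apply, one_apply_eq_self, inner_sub_left,
      inner_add_left, inner_smul_left, ContinuousLinearMap.adjoint_inner_left,
      map_sub, map_add, Complex.conj_ofReal]
    have h := inner_re_symm (𝕜 := ℂ) x (toEuclideanCLM (𝕜 := ℂ) T x)
    have hx := inner_self_eq_norm_sq (𝕜 := ℂ) x
    simp only [RCLike.re_to_complex] at h hx ⊢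
    rw [h, Complex.re_ofReal_mul, hx]
    ring
  rw [key, sub_nonneg]

theorem opN_inv_smul_lt_one_iff {m : Type*} [Fintype m] [DecidableEq m] {a : ℝ} (ha : 0 < a)
    (T : Matrix m m ℂ) : opN ((a : ℂ)⁻¹ • T) < 1 ↔ opN T < a := by
  rw [opN, map_smul, norm_smul, norm_inv, Complex.norm_real, Real.norm_of_nonneg ha.le,
    inv_mul_lt_one₀ ha, opN]

theorem norm_toEuclideanCLM_add_smul_one_sq {m : Type*} [Fintype m] [DecidableEq m] (R : ℝ)
    (T : Matrix m m ℂ) (x : EuclideanSpace ℂ m) :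
    ‖Matrix.toEuclideanCLM (𝕜 := ℂ) (T + (R : ℂ) • (1 : Matrix m m ℂ)) x‖ ^ 2 =
      ‖Matrix.toEuclideanCLM (𝕜 := ℂ) T x‖ ^ 2
        + R * (2 * (inner ℂ (Matrix.toEuclideanCLM (𝕜 := ℂ) T x) x).re) + R ^ 2 * ‖x‖ ^ 2 := by
  rw [map_add, map_smul, map_one, add_apply, smul_apply,
    one_apply_eq_self, norm_add_sq (𝕜 := ℂ), inner_smul_right, norm_smul,
    RCLike.re_to_complex, Complex.re_ofReal_mul, Complex.norm_real, mul_pow, Real.norm_eq_abs,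
    sq_abs]
  ring

/-- The half-plane `T + Tᴴ ≤ 1`, cut by the ball of radius `M`, lies in a large ball
centred at `-R`. -/
theorem opN_add_smul_one_lt {m : Type*} [Fintype m] [DecidableEq m] {M R r : ℝ} (hR : 0 ≤ R)
    (hr : 0 < r) (hMr : M ^ 2 + R + R ^ 2 < r ^ 2) {T : Matrix m m ℂ}
    (hT : ((1 : Matrix m m ℂ) - (T + Tᴴ)).PosSemidef) (hTM : opN T < M) :
    opN (T + (R : ℂ) • (1 : Matrix m m ℂ)) < r := by
  have hre := (posSemidef_smul_one_sub_add_conjTranspose_iff 1 T).1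
    (by rwa [Complex.ofReal_one, one_smul])
  refine (ContinuousLinearMap.opNorm_le_bound _ (Real.sqrt_nonneg (M ^ 2 + R + R ^ 2))
    fun x => ?_).trans_lt ((Real.sqrt_lt' hr).2 hMr)
  refine le_of_sq_le_sq ?_ (by positivity)
  rw [norm_toEuclideanCLM_add_smul_one_sq, mul_pow, Real.sq_sqrt (by positivity)]
  have hx : ‖Matrix.toEuclideanCLM (𝕜 := ℂ) T x‖ ^ 2 ≤ (M * ‖x‖) ^ 2 := by
    gcongr
    exact ContinuousLinearMap.le_of_opNorm_le _ hTM.le x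
  linarith [mul_le_mul_of_nonneg_left (hre x) hR]

/-- The ball of radius `√(R ^ 2 + c * R)` centred at `-R` lies in the half-plane `T + Tᴴ ≤ c`. -/
theorem posSemidef_of_opN_add_smul_one_lt {m : Type*} [Fintype m] [DecidableEq m] {c R r : ℝ}
    (hR : 0 < R) (hr : r ^ 2 = R ^ 2 + c * R) {T : Matrix m m ℂ}
    (hT : opN (T + (R : ℂ) • (1 : Matrix m m ℂ)) < r) :
    ((c : ℂ) • (1 : Matrix m m ℂ) - (T + Tᴴ)).PosSemidef := by
  refine (posSemidef_smul_one_sub_add_conjTranspose_iff c T).2 fun x => ?_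
  have hx := pow_le_pow_left₀ (norm_nonneg _) (ContinuousLinearMap.le_of_opNorm_le _ hT.le x) 2
  rw [norm_toEuclideanCLM_add_smul_one_sq, mul_pow, hr] at hx
  refine le_of_mul_le_mul_left ?_ hR
  linarith [sq_nonneg ‖Matrix.toEuclideanCLM (𝕜 := ℂ) T x‖]

/-- For each `M > 0` and `1 < C < 2` there are polynomials `s₁, s₂` such that
`F_{1,M} ⊆ {T : ‖s₁(T)‖ < 1 and ‖s₂(T)‖ < 1} ⊆ F_{C,M}`. -/
theorem polynomial_sandwich_of_frakF :
    ∀ M c : ℝ, 0 < M → 1 < c → c < 2 →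
      ∃ s₁ s₂ : Polynomial ℂ,
        ∀ (n : ℕ) (T : Matrix (Fin n) (Fin n) ℂ),
          ((((1 : Matrix (Fin n) (Fin n) ℂ) - (T + Tᴴ)).PosSemidef ∧ opN T < M) →
            opN ((Polynomial.aeval T) s₁) < 1 ∧ opN ((Polynomial.aeval T) s₂) < 1) ∧
          ((opN ((Polynomial.aeval T) s₁) < 1 ∧ opN ((Polynomial.aeval T) s₂) < 1) →
            ((c : ℂ) • (1 : Matrix (Fin n) (Fin n) ℂ) - (T + Tᴴ)).PosSemidef ∧ opN T < M) := by
  intro M c hM hc _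
  have hc' : 0 < c - 1 := sub_pos.2 hc
  obtain ⟨R, hR, hcR⟩ : ∃ R : ℝ, 0 < R ∧ R * (c - 1) = M ^ 2 + 1 :=
    ⟨(M ^ 2 + 1) / (c - 1), by positivity, div_mul_cancel₀ _ hc'.ne'⟩
  have hpos : 0 < R ^ 2 + c * R := by positivity
  obtain ⟨r, hr, hr2⟩ : ∃ r : ℝ, 0 < r ∧ r ^ 2 = R ^ 2 + c * R :=
    ⟨√(R ^ 2 + c * R), Real.sqrt_pos.2 hpos, Real.sq_sqrt hpos.le⟩
  refine ⟨(r : ℂ)⁻¹ • (Polynomial.X + Polynomial.C (R : ℂ)), (M : ℂ)⁻¹ • Polynomial.X,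
    fun n T => ?_⟩
  simp only [map_smul, map_add, Polynomial.aeval_X, Polynomial.aeval_C,
    Algebra.algebraMap_eq_smul_one, opN_inv_smul_lt_one_iff hr, opN_inv_smul_lt_one_iff hM]
  exact ⟨fun ⟨hT, hTM⟩ => ⟨opN_add_smul_one_lt hR.le hr (by linarith) hT hTM, hTM⟩,
    fun ⟨hT, hTM⟩ => ⟨posSemidef_of_opN_add_smul_one_lt hR hr2 hT, hTM⟩⟩
end

section
/- Let e be a positive integer, E a complex Hilbert space, A = (A_1,…,A_g) a g-tuple of bounded operators on E, W_α : ℂ^e → E bounded linear maps indexed by words α in g letters, and G_α ∈ M_e(ℂ) with G_∅ = 0, and suppose the coefficient identities hold: for all words α, β and all 1 ≤ j,k ≤ g, W_β^* A_k^* W_{x_jα} + W_{x_kβ}^* A_j W_α + W_{x_kβ}^* W_{x_jα} = 0, W_∅^*(A_k W_α + W_{x_kα}) = G_{x_kα}, and W_∅^* W_∅ = I. Then 𝒲 := W_∅ is an isometry and there exists a contraction C on E, isometric on the span of {A_j W_α h : 1 ≤ j ≤ g, α a word, h ∈ ℂ^e}, such that W_{x_jα} = (C−I)A_j W_α for all j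 and α. Consequently, with R_j = (C−I)A_j, one has W_α = R^α 𝒲 for every word α, and G_{x_jα} = 𝒲^* C A_j R^α 𝒲 for every word α and every j. Moreover, if E is finite dimensional, C can be chosen unitary. Conversely, given a g-tuple A of bounded operators on E, a contraction C on E isometric on the range of A, and an isometry 𝒲 : ℂ^e → E, defining R = (C−I)A, W_α = R^α 𝒲, G_∅ = 0 and G_{x_jα} = 𝒲^* C A_j R^α 𝒲, the above coefficient identities hold. -/
open scoped Matrix
open ContinuousLinearMap (adjoint)

/-- The product of continuous linear operators along the word `α` (empty word ↦ identity). -/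
noncomputable def opWordProd {g : ℕ} {E : Type*} [NormedAddCommGroup E]
    [InnerProductSpace ℂ E] (R : Fin g → (E →L[ℂ] E)) (α : List (Fin g)) : E →L[ℂ] E :=
  (α.map R).prod

/-- The coefficients `G_∅ = 0`, `G_{x_j α} = 𝒲^* C A_j R^α 𝒲` (with `R = (C−I)A`),
written as `e × e` matrices. -/
noncomputable def Gof {g e : ℕ} {E : Type*} [NormedAddCommGroup E]
    [InnerProductSpace ℂ E] [CompleteSpace E]
    (A : Fin g → (E →L[ℂ] E)) (C : E →L[ℂ] E)
    (𝒲 : EuclideanSpace ℂ (Fin e) →L[ℂ] E) :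
    List (Fin g) → Matrix (Fin e) (Fin e) ℂ
  | [] => 0
  | j :: α =>
      (Matrix.toEuclideanCLM (𝕜 := ℂ) (n := Fin e)).symm
        (adjoint 𝒲 ∘L C ∘L A j ∘L opWordProd (fun i => (C - 1) ∘L A i) α ∘L 𝒲)

/-- A bounded operator that preserves norms on a subspace preserves inner products there. -/
theorem inner_map_map_of_norm_map_eq {E F : Type*} [NormedAddCommGroup E] [InnerProductSpace ℂ E]
    [NormedAddCommGroup F] [InnerProductSpace ℂ F] (C : E →L[ℂ] F) (S : Submodule ℂ E)
    (hC : ∀ v ∈ S, ‖C v‖ = ‖v‖) {u v : E} (hu : u ∈ S) (hv : v ∈ S) :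
    inner ℂ (C u) (C v) = inner ℂ u v :=
  LinearIsometry.inner_map_map
    (⟨C.toLinearMap ∘ₗ S.subtype, fun x => hC x x.2⟩ : S →ₗᵢ[ℂ] F) ⟨u, hu⟩ ⟨v, hv⟩

/-- Two families with the same Gram matrix are related by an isometry defined on the closed span
of the first one. -/
theorem exists_linearIsometry_of_inner_eq {ι E F : Type*} [NormedAddCommGroup E]
    [InnerProductSpace ℂ E] [NormedAddCommGroup F] [InnerProductSpace ℂ F] [CompleteSpace F]
    (p : ι → E) (r : ι → F) (h : ∀ i j, inner ℂ (r i) (r j) = inner ℂ (p i) (p j)) :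
    ∃ V : (Submodule.span ℂ (Set.range p)).topologicalClosure →ₗᵢ[ℂ] F,
      ∀ (i : ι) (hi : p i ∈ (Submodule.span ℂ (Set.range p)).topologicalClosure),
        V ⟨p i, hi⟩ = r i := by
  set K := (Submodule.span ℂ (Set.range p)).topologicalClosure
  have hmem : ∀ x : ι →₀ ℂ, Finsupp.linearCombination ℂ p x ∈ K := fun x =>
    Submodule.le_topologicalClosure _ (Finsupp.range_linearCombination ℂ (v := p) ▸ ⟨x, rfl⟩)
  let P : (ι →₀ ℂ) →ₗ[ℂ] K := (Finsupp.linearCombination ℂ p).codRestrict K hmem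
  let Q : (ι →₀ ℂ) →ₗ[ℂ] F := Finsupp.linearCombination ℂ r
  have hnorm : ∀ x, ‖Q x‖ = ‖P x‖ := fun x => by
    change ‖Finsupp.linearCombination ℂ r x‖ = ‖Finsupp.linearCombination ℂ p x‖
    rw [@norm_eq_sqrt_re_inner ℂ, @norm_eq_sqrt_re_inner ℂ]
    simp only [Finsupp.linearCombination_apply, Finsupp.sum_inner, Finsupp.inner_sum, h,
      inner_smul_left, inner_smul_right]
  have hdense : DenseRange P := by
    intro y
    rw [closure_subtype]
    have himage : ((↑) '' Set.range P : Set E) = Submodule.span ℂ (Set.range p) := by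
      rw [← Finsupp.range_linearCombination ℂ, ← Set.range_comp]
      rfl
    rw [himage]
    exact y.2
  have hbound : ∃ c : ℝ, ∀ x, ‖Q x‖ ≤ c * ‖P x‖ := ⟨1, fun x => by rw [one_mul, hnorm]⟩
  have hV : ∀ x, Q.extendOfNorm P (P x) = Q x := LinearMap.extendOfNorm_eq hdense hbound
  refine ⟨⟨(Q.extendOfNorm P).toLinearMap, fun y => ?_⟩, fun i hi => ?_⟩
  · exact hdense.induction_on (p := fun y => ‖Q.extendOfNorm P y‖ = ‖y‖) y
      (isClosed_eq (by fun_prop) (by fun_prop)) fun x => by rw [hV, hnorm]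
  · have hPi : P (Finsupp.single i 1) = ⟨p i, hi⟩ := Subtype.ext (by simp [P])
    have := hV (Finsupp.single i 1)
    rw [hPi] at this
    simpa [Q] using this

/-- The word product of the empty word is the identity. -/
theorem opWordProd_nil {g : ℕ} {E : Type*} [NormedAddCommGroup E] [InnerProductSpace ℂ E]
    (R : Fin g → (E →L[ℂ] E)) : opWordProd R [] = 1 := by
  simp [opWordProd]

/-- The word product of `x_j α` is `R_j R^α`. -/
theorem opWordProd_cons {g : ℕ} {E : Type*} [NormedAddCommGroup E] [InnerProductSpace ℂ E]
    (R : Fin g → (E →L[ℂ] E)) (j : Fin g) (α : List (Fin g)) :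
    opWordProd R (j :: α) = R j ∘L opWordProd R α := by
  simp [opWordProd, ContinuousLinearMap.mul_def]

/-- A family satisfying `W_{x_j α} = R_j W_α` is given by the word products of `R`. -/
theorem eq_opWordProd_comp {g : ℕ} {E F : Type*} [NormedAddCommGroup E] [InnerProductSpace ℂ E]
    [NormedAddCommGroup F] [InnerProductSpace ℂ F]
    (R : Fin g → (E →L[ℂ] E)) (W : List (Fin g) → (F →L[ℂ] E))
    (hW : ∀ j α, W (j :: α) = R j ∘L W α) (α : List (Fin g)) :
    W α = opWordProd R α ∘L W [] := by
  induction α with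
  | nil => simp [opWordProd_nil, ContinuousLinearMap.one_def]
  | cons j α ih => rw [hW, opWordProd_cons, ContinuousLinearMap.comp_assoc, ← ih]

/-- If `C A_j W_α = A_j W_α + W_{x_j α}`, then `W_α` and `W_∅^* (A_j W_α + W_{x_j α})` are
expressed through the word products of `R = (C - 1) A`. -/
theorem word_formulas_of_apply_eq {g : ℕ} {E F : Type*} [NormedAddCommGroup E]
    [InnerProductSpace ℂ E] [CompleteSpace E] [NormedAddCommGroup F] [InnerProductSpace ℂ F]
    [CompleteSpace F] (A : Fin g → (E →L[ℂ] E)) (W : List (Fin g) → (F →L[ℂ] E)) (C : E →L[ℂ] E)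
    (hC : ∀ j α x, C (A j (W α x)) = A j (W α x) + W (j :: α) x) :
    (∀ j α, W (j :: α) = ((C - 1) ∘L A j) ∘L W α) ∧
      (∀ α, W α = opWordProd (fun i => (C - 1) ∘L A i) α ∘L W []) ∧
      ∀ j α, adjoint (W []) ∘L (A j ∘L W α + W (j :: α)) =
        adjoint (W []) ∘L C ∘L A j ∘L opWordProd (fun i => (C - 1) ∘L A i) α ∘L W [] := by
  have hrec : ∀ j α, W (j :: α) = ((C - 1) ∘L A j) ∘L W α := fun j α => by
    ext x
    simp [hC]
  have hword := eq_opWordProd_comp (fun i => (C - 1) ∘L A i) W hrec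
  refine ⟨hrec, hword, fun j α => ?_⟩
  rw [← hword α]
  congr 1
  ext x
  simp [hC]

/-- The first coefficient identity says that `A_j W_α + W_{x_j α}` and `A_j W_α` have the same
Gram matrix. -/
theorem coefficient_identity_iff {E F : Type*} [NormedAddCommGroup E] [InnerProductSpace ℂ E]
    [CompleteSpace E] [NormedAddCommGroup F] [InnerProductSpace ℂ F] [CompleteSpace F]
    (Wα Wβ Wj Wk : F →L[ℂ] E) (Aj Ak : E →L[ℂ] E) :
    adjoint Wβ ∘L adjoint Ak ∘L Wj + adjoint Wk ∘L Aj ∘L Wα + adjoint Wk ∘L Wj = 0 ↔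
      ∀ x y, inner ℂ (Ak (Wβ x) + Wk x) (Aj (Wα y) + Wj y) =
        inner ℂ (Ak (Wβ x)) (Aj (Wα y)) := by
  have key : ∀ x y, inner ℂ x ((adjoint Wβ ∘L adjoint Ak ∘L Wj + adjoint Wk ∘L Aj ∘L Wα +
      adjoint Wk ∘L Wj) y) = inner ℂ (Ak (Wβ x) + Wk x) (Aj (Wα y) + Wj y) -
        inner ℂ (Ak (Wβ x)) (Aj (Wα y)) := fun x y => by
    simp only [add_apply, ContinuousLinearMap.comp_apply, inner_add_left,
      inner_add_right, ContinuousLinearMap.adjoint_inner_right]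
    ring
  constructor
  · intro h x y
    have := key x y
    rw [h, zero_apply, inner_zero_right] at this
    exact sub_eq_zero.mp this.symm
  · intro h
    ext y
    refine ext_inner_left ℂ fun x => ?_
    rw [key, h, sub_self, zero_apply, inner_zero_right]

/-- Structure of solutions of the formal identity `I + G + G^* = W^* L_A W`: the constant
coefficient `𝒲 = W_∅` is an isometry and there is a contraction `C`, isometric on the span
of the vectors `A_j W_α h`, with `W_{x_j α} = (C−I) A_j W_α`; consequently, with
`R = (C−I)A`, `W_α = R^α 𝒲` and `G_{x_j α} = 𝒲^* C A_j R^α 𝒲`.  If `E` is finite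
dimensional, `C` can be chosen unitary.  Conversely, for any contraction `C` isometric on
the range of `A` and any isometry `𝒲`, these formulas produce a solution of the
coefficient identities. -/
theorem one_term_certificate_structure {g e : ℕ} (he : 0 < e)
    (E : Type*) [NormedAddCommGroup E] [InnerProductSpace ℂ E] [CompleteSpace E]
    (A : Fin g → (E →L[ℂ] E)) :
    (∀ (W : List (Fin g) → (EuclideanSpace ℂ (Fin e) →L[ℂ] E))
        (G : List (Fin g) → Matrix (Fin e) (Fin e) ℂ),
      G [] = 0 →
      (∀ (α β : List (Fin g)) (j k : Fin g),
        adjoint (W β) ∘L adjoint (A k) ∘L W (j :: α) +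
          adjoint (W (k :: β)) ∘L (A j) ∘L W α +
          adjoint (W (k :: β)) ∘L W (j :: α) = 0) →
      (∀ (k : Fin g) (α : List (Fin g)),
        adjoint (W []) ∘L ((A k) ∘L W α + W (k :: α)) =
          Matrix.toEuclideanCLM (𝕜 := ℂ) (G (k :: α))) →
      adjoint (W []) ∘L W [] = 1 →
      ((∀ x : EuclideanSpace ℂ (Fin e), ‖W [] x‖ = ‖x‖) ∧
       (∃ C : E →L[ℂ] E, ‖C‖ ≤ 1 ∧
          (∀ v ∈ Submodule.span ℂ
              {v : E | ∃ (j : Fin g) (α : List (Fin g)) (h : EuclideanSpace ℂ (Fin e)),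
                v = A j (W α h)}, ‖C v‖ = ‖v‖) ∧
          (∀ (j : Fin g) (α : List (Fin g)),
            W (j :: α) = ((C - 1) ∘L A j) ∘L W α) ∧
          (∀ α : List (Fin g),
            W α = (opWordProd (fun i => (C - 1) ∘L A i) α) ∘L W []) ∧
          (∀ (j : Fin g) (α : List (Fin g)),
            Matrix.toEuclideanCLM (𝕜 := ℂ) (G (j :: α)) =
              adjoint (W []) ∘L C ∘L A j ∘L
                opWordProd (fun i => (C - 1) ∘L A i) α ∘L W [])) ∧
       (FiniteDimensional ℂ E →
         ∃ C : E →L[ℂ] E,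
           (adjoint C ∘L C = 1 ∧ C ∘L adjoint C = 1) ∧
           (∀ (j : Fin g) (α : List (Fin g)),
             W (j :: α) = ((C - 1) ∘L A j) ∘L W α) ∧
           (∀ α : List (Fin g),
             W α = (opWordProd (fun i => (C - 1) ∘L A i) α) ∘L W []) ∧
           (∀ (j : Fin g) (α : List (Fin g)),
             Matrix.toEuclideanCLM (𝕜 := ℂ) (G (j :: α)) =
               adjoint (W []) ∘L C ∘L A j ∘L
                 opWordProd (fun i => (C - 1) ∘L A i) α ∘L W [])))) ∧
    (∀ (C : E →L[ℂ] E) (𝒲 : EuclideanSpace ℂ (Fin e) →L[ℂ] E),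
      ‖C‖ ≤ 1 →
      (∀ v ∈ Submodule.span ℂ (⋃ j : Fin g, Set.range (A j)), ‖C v‖ = ‖v‖) →
      (∀ x : EuclideanSpace ℂ (Fin e), ‖𝒲 x‖ = ‖x‖) →
      (let R : Fin g → (E →L[ℂ] E) := fun i => (C - 1) ∘L A i
       let W : List (Fin g) → (EuclideanSpace ℂ (Fin e) →L[ℂ] E) :=
         fun α => (opWordProd R α) ∘L 𝒲
       (∀ (α β : List (Fin g)) (j k : Fin g),
          adjoint (W β) ∘L adjoint (A k) ∘L W (j :: α) +
            adjoint (W (k :: β)) ∘L (A j) ∘L W α +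
            adjoint (W (k :: β)) ∘L W (j :: α) = 0) ∧
        (∀ (k : Fin g) (α : List (Fin g)),
          adjoint (W []) ∘L ((A k) ∘L W α + W (k :: α)) =
            Matrix.toEuclideanCLM (𝕜 := ℂ) (Gof A C 𝒲 (k :: α))) ∧
        adjoint (W []) ∘L W [] = 1)) := by
  refine ⟨fun W G _ hW hG hI => ?_, fun C 𝒲 _ hiso h𝒲 => ?_⟩
  · let p : Fin g × List (Fin g) × EuclideanSpace ℂ (Fin e) → E := fun i => A i.1 (W i.2.1 i.2.2)
    obtain ⟨V, hV⟩ := exists_linearIsometry_of_inner_eq p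
      (fun i => p i + W (i.1 :: i.2.1) i.2.2)
      fun i j => (coefficient_identity_iff _ _ _ _ _ _).mp (hW j.2.1 i.2.1 j.1 i.1) i.2.2 j.2.2
    have hp : ∀ i, p i ∈ (Submodule.span ℂ (Set.range p)).topologicalClosure := fun i =>
      Submodule.le_topologicalClosure _ (Submodule.subset_span ⟨i, rfl⟩)
    refine ⟨(W []).norm_map_iff_adjoint_comp_self.mpr hI, ?_, fun _ => ?_⟩
    · let K := (Submodule.span ℂ (Set.range p)).topologicalClosure
      have : CompleteSpace K :=
        (Submodule.isClosed_topologicalClosure _).completeSpace_coe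
      let C : E →L[ℂ] E := V.toContinuousLinearMap ∘L K.orthogonalProjectionOnto
      have hCK : ∀ (v : E) (hv : v ∈ K), C v = V ⟨v, hv⟩ := fun v hv =>
        congrArg V (K.orthogonalProjectionOnto_mem_subspace_eq_self ⟨v, hv⟩)
      obtain ⟨h₁, h₂, h₃⟩ := word_formulas_of_apply_eq A W C fun j α x =>
        (hCK _ (hp (j, α, x))).trans (hV (j, α, x) _)
      refine ⟨C, ?_, fun v hv => ?_, h₁, h₂, fun j α => (hG j α).symm.trans (h₃ j α)⟩
      · refine C.opNorm_le_bound zero_le_one fun v => ?_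
        rw [one_mul]
        exact (V.norm_map _).trans_le (K.norm_orthogonalProjectionOnto_apply_le v)
      · have hvK : v ∈ K := by
          refine Submodule.le_topologicalClosure _ (Submodule.span_mono ?_ hv)
          rintro _ ⟨j, α, x, rfl⟩
          exact ⟨(j, α, x), rfl⟩
        rw [hCK v hvK]
        exact V.norm_map _
    · let C : E →L[ℂ] E := V.extend.toContinuousLinearMap
      obtain ⟨h₁, h₂, h₃⟩ := word_formulas_of_apply_eq A W C fun j α x =>
        (V.extend_apply ⟨p (j, α, x), hp _⟩).trans (hV (j, α, x) _)
      have hC : adjoint C ∘L C = 1 :=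
        C.norm_map_iff_adjoint_comp_self.mp V.extend.norm_map
      have hC' : C ∘L adjoint C = 1 := by
        ext v
        obtain ⟨w, rfl⟩ := LinearMap.injective_iff_surjective.mp V.extend.injective v
        exact congrArg C (DFunLike.congr_fun hC w)
      exact ⟨C, ⟨hC, hC'⟩, h₁, h₂, fun j α => (hG j α).symm.trans (h₃ j α)⟩
  · intro R W
    have hC : ∀ j α x, C (A j (W α x)) = A j (W α x) + W (j :: α) x := fun j α x => by
      simp [W, R, opWordProd_cons]
    have hW₀ : W [] = 𝒲 := by
      simp [W, opWordProd_nil, ContinuousLinearMap.one_def]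
    have hA : ∀ j v, A j v ∈ Submodule.span ℂ (⋃ j : Fin g, Set.range (A j)) := fun j v =>
      Submodule.subset_span (Set.mem_iUnion.mpr ⟨j, v, rfl⟩)
    refine ⟨fun α β j k => ?_, fun k α => ?_, ?_⟩
    · refine (coefficient_identity_iff _ _ _ _ _ _).mpr fun x y => ?_
      rw [← hC, ← hC]
      exact inner_map_map_of_norm_map_eq C _ hiso (hA _ _) (hA _ _)
    · rw [(word_formulas_of_apply_eq A W C hC).2.2 k α, hW₀]
      exact (StarAlgEquiv.apply_symm_apply _ _).symm
    · rw [hW₀]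
      exact 𝒲.norm_map_iff_adjoint_comp_self.mp h𝒲
end

section
/- Fix positive integers g and N, let W_N denote the set of words of length at most N in g letters, and let S_1,…,S_g be the truncated Fock shifts: the W_N × W_N complex matrices with (S_j)_{w',w} = 1 if |w| < N and w' is the word x_j w (the letter j prefixed to w), and (S_j)_{w',w} = 0 otherwise. Let H and K be complex vector spaces and let F_{α,β} : H → K be linear maps indexed by pairs of words α, β ∈ W_N. If Σ_{α,β} F_{α,β} ⊗ S^β (S^α)^* = 0 — that is, if for every pair w, w' ∈ W_N the linear map Σ_{α,β} (S^β (S^α)^*)_{w',w} · F_{α,β} : H → K is zero — then F_{α,β} = 0 for all α, β ∈ W_N. -/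
open scoped Matrix

/-- The words of length at most `N` in `g` letters form a finite type. -/
noncomputable instance wordsFintype {g N : ℕ} : Fintype {w : List (Fin g) // w.length ≤ N} :=
  (List.finite_length_le (Fin g) N).fintype

/-- The product of matrices from the tuple `T` along the word `α` (empty word ↦ identity). -/
noncomputable def wprod {g : ℕ} {m : Type*} [Fintype m] [DecidableEq m]
    (T : Fin g → Matrix m m ℂ) (α : List (Fin g)) : Matrix m m ℂ :=
  (α.map T).prod

/-- The truncated Fock shift `S_j` on the truncated Fock space with basis the words of
length at most `N`: the entry at `(w', w)` is `1` if `|w| < N` and `w' = x_j w`, else `0`. -/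
noncomputable def fockShift (g N : ℕ) (j : Fin g) :
    Matrix {w : List (Fin g) // w.length ≤ N} {w : List (Fin g) // w.length ≤ N} ℂ :=
  Matrix.of fun w' w => if w.1.length < N ∧ w'.1 = j :: w.1 then 1 else 0

/-- The product of truncated Fock shifts along `α` prefixes `α` to a word. -/
lemma wprod_fockShift_apply {g N : ℕ} (α : List (Fin g))
    (w' w : {w : List (Fin g) // w.length ≤ N}) :
    wprod (fockShift g N) α w' w = if w'.1 = α ++ w.1 then 1 else 0 := by
  induction α generalizing w' with
  | nil => simp [wprod, Matrix.one_apply, Subtype.ext_iff]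
  | cons j α ih =>
    have hcons : wprod (fockShift g N) (j :: α) =
        fockShift g N j * wprod (fockShift g N) α := by simp [wprod]
    rw [hcons, Matrix.mul_apply]
    simp only [ih, fockShift, Matrix.of_apply]
    split_ifs with h
    · have hw' := w'.2
      rw [h] at hw'
      simp only [List.cons_append, List.length_cons] at hw'
      rw [Finset.sum_eq_single ⟨α ++ w.1, by omega⟩]
      · simp only [h, List.cons_append, and_true, if_true, mul_one]
        exact if_pos (by omega)
      · intro u _ hu
        rw [if_neg (fun h' : u.1 = α ++ w.1 => hu (Subtype.ext h')), mul_zero]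
      · simp
    · refine Finset.sum_eq_zero fun u _ => ?_
      split_ifs with h₁ h₂
      · exact absurd (by rw [h₁.2, h₂, List.cons_append]) h
      all_goals simp

/-- A nonzero entry of `S^β (S^α)^*` comes from a common suffix of its two indices. -/
lemma exists_suffix_of_wprod_mul_conjTranspose_ne_zero {g N : ℕ} {α β : List (Fin g)}
    {w' w : {w : List (Fin g) // w.length ≤ N}}
    (h : (wprod (fockShift g N) β * (wprod (fockShift g N) α)ᴴ) w' w ≠ 0) :
    ∃ u, w'.1 = β ++ u ∧ w.1 = α ++ u := by
  rw [Matrix.mul_apply] at h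
  obtain ⟨u, -, hu⟩ := Finset.exists_ne_zero_of_sum_ne_zero h
  refine ⟨u.1, ?_⟩
  simpa [wprod_fockShift_apply, and_comm] using hu

/-- The entry of `S^β (S^α)^*` at `(β, α)` is `1`. -/
lemma wprod_mul_conjTranspose_self_apply {g N : ℕ}
    (α β : {w : List (Fin g) // w.length ≤ N}) :
    (wprod (fockShift g N) β.1 * (wprod (fockShift g N) α.1)ᴴ) β α = 1 := by
  rw [Matrix.mul_apply, Finset.sum_eq_single ⟨[], Nat.zero_le N⟩]
  · simp [wprod_fockShift_apply]
  · intro u _ hu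
    have hne : u.1 ≠ [] := fun h => hu (Subtype.ext h)
    simp [wprod_fockShift_apply, hne]
  · simp

/-- If `Σ_{α,β} F_{α,β} ⊗ S^β (S^α)^* = 0` for linear maps `F_{α,β}` indexed by words of
length at most `N`, where `S` is the tuple of truncated Fock shifts, then all `F_{α,β} = 0`. -/
theorem fock_shift_linear_independence {g N : ℕ}
    (H K : Type*) [AddCommGroup H] [Module ℂ H] [AddCommGroup K] [Module ℂ K]
    (F : {w : List (Fin g) // w.length ≤ N} → {w : List (Fin g) // w.length ≤ N} →
      (H →ₗ[ℂ] K))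
    (hzero : ∀ w' w : {w : List (Fin g) // w.length ≤ N},
      (∑ α : {w : List (Fin g) // w.length ≤ N},
        ∑ β : {w : List (Fin g) // w.length ≤ N},
          ((wprod (fockShift g N) β.1 * (wprod (fockShift g N) α.1)ᴴ) w' w) • F α β) = 0) :
    ∀ α β : {w : List (Fin g) // w.length ≤ N}, F α β = 0 := by
  intro α
  induction hn : α.1.length using Nat.strong_induction_on generalizing α with
  | _ n ih =>
    intro β
    have h := hzero β α
    rw [Finset.sum_eq_single α, Finset.sum_eq_single β,
      wprod_mul_conjTranspose_self_apply, one_smul] at h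
    · exact h
    · intro β' _ hβ'
      by_contra hne
      obtain ⟨u, hβ, hα⟩ :=
        exists_suffix_of_wprod_mul_conjTranspose_ne_zero (left_ne_zero_of_smul hne)
      have hu : u = [] := by simpa using hα
      exact hβ' (Subtype.ext (by simpa [hu] using hβ.symm))
    · simp
    · intro α' _ hα'
      refine Finset.sum_eq_zero fun β' _ => ?_
      by_contra hne
      obtain ⟨u, -, hα⟩ :=
        exists_suffix_of_wprod_mul_conjTranspose_ne_zero (left_ne_zero_of_smul hne)
      have hu : u ≠ [] := fun hu => hα' (Subtype.ext (by simpa [hu] using hα.symm))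
      have hlen := congrArg List.length hα
      rw [List.length_append] at hlen
      have hpos := List.length_pos_iff.mpr hu
      exact right_ne_zero_of_smul hne (ih _ (by omega) α' rfl β')
    · simp
end

section
/- Let A ∈ M_d(ℂ)^g. The free spectrahedron D_A is bounded if and only if for every nonzero α ∈ ℂ^g the Hermitian matrix Λ_A(α) + Λ_A(α)^* = Σ_j α_j A_j + Σ_j conj(α_j) A_j^* has both a strictly positive and a strictly negative eigenvalue. -/
open scoped Kronecker Matrix ComplexOrder

/-- The monic linear pencil `L_A(X) = I⊗I + Σ_j A_j ⊗ X_j + Σ_j A_j^* ⊗ X_j^*`. -/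
noncomputable def pencil {g d n : ℕ} (A : Fin g → Matrix (Fin d) (Fin d) ℂ)
    (X : Fin g → Matrix (Fin n) (Fin n) ℂ) : Matrix (Fin d × Fin n) (Fin d × Fin n) ℂ :=
  1 + lamEval A X + (lamEval A X)ᴴ

/-- The free spectrahedron `D_A` is bounded. -/
def BoundedFS {g d : ℕ} (A : Fin g → Matrix (Fin d) (Fin d) ℂ) : Prop :=
  ∃ N : ℝ, ∀ (n : ℕ) (X : Fin g → Matrix (Fin n) (Fin n) ℂ),
    (pencil A X).PosSemidef → ∀ j : Fin g, opN (X j) ≤ N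

/-- A real-linear form that is negative somewhere at each point of a compact set is uniformly so. -/
lemma exists_uniform_neg_form {g d : ℕ} (A : Fin g → Matrix (Fin d) (Fin d) ℂ)
    (h : ∀ α : Fin g → ℂ, α ≠ 0 → ∃ v : Fin d → ℂ,
      (star v ⬝ᵥ (∑ j, α j • A j) *ᵥ v).re < 0) :
    ∃ ε : ℝ, 0 < ε ∧ ∀ α ∈ Metric.sphere (0 : Fin g → ℂ) 1, ∃ v : Fin d → ℂ, v ≠ 0 ∧
      (star v ⬝ᵥ (∑ j, α j • A j) *ᵥ v).re ≤ -ε * (star v ⬝ᵥ v).re := by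
  refine IsCompact.induction_on (p := fun s => ∃ ε : ℝ, 0 < ε ∧ ∀ α ∈ s, ∃ v : Fin d → ℂ, v ≠ 0 ∧
      (star v ⬝ᵥ (∑ j, α j • A j) *ᵥ v).re ≤ -ε * (star v ⬝ᵥ v).re)
      (isCompact_sphere (0 : Fin g → ℂ) 1) ⟨1, one_pos, by simp⟩ ?_ ?_ ?_
  · rintro s t hst ⟨ε, hε, H⟩
    exact ⟨ε, hε, fun α hα => H α (hst hα)⟩
  · rintro s t ⟨ε, hε, H⟩ ⟨δ, hδ, K⟩
    refine ⟨min ε δ, lt_min hε hδ, fun α hα => ?_⟩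
    rcases hα with hα | hα
    · obtain ⟨v, hv, hle⟩ := H α hα
      have h0 : 0 ≤ (star v ⬝ᵥ v).re :=
        (Complex.nonneg_iff.1 (dotProduct_star_self_nonneg v)).1
      exact ⟨v, hv, hle.trans (by nlinarith [min_le_left ε δ])⟩
    · obtain ⟨v, hv, hle⟩ := K α hα
      have h0 : 0 ≤ (star v ⬝ᵥ v).re :=
        (Complex.nonneg_iff.1 (dotProduct_star_self_nonneg v)).1
      exact ⟨v, hv, hle.trans (by nlinarith [min_le_right ε δ])⟩
  · intro β hβ
    have hβ0 : β ≠ 0 := by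
      rintro rfl
      simp at hβ
    obtain ⟨v, hv⟩ := h β hβ0
    have hv0 : v ≠ 0 := by
      rintro rfl
      simp at hv
    have hpos : 0 < (star v ⬝ᵥ v).re :=
      (Complex.pos_iff.1 (Matrix.dotProduct_star_self_pos_iff.2 hv0)).1
    have hcont : Continuous fun α : Fin g → ℂ => (star v ⬝ᵥ (∑ j, α j • A j) *ᵥ v).re := by
      fun_prop
    set q := (star v ⬝ᵥ (∑ j, β j • A j) *ᵥ v).re
    refine ⟨{α | (star v ⬝ᵥ (∑ j, α j • A j) *ᵥ v).re < q / 2},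
      mem_nhdsWithin_of_mem_nhds ((isOpen_lt hcont continuous_const).mem_nhds ?_),
      -(q / 2) / (star v ⬝ᵥ v).re, by apply div_pos <;> linarith, fun α hα => ⟨v, hv0, ?_⟩⟩
    · change q < q / 2
      linarith
    · have : -(-(q / 2) / (star v ⬝ᵥ v).re) * (star v ⬝ᵥ v).re = q / 2 := by
        field_simp
      rw [this]
      exact le_of_lt hα

lemma exists_norm_le_of_form_nonneg {g d : ℕ} (A : Fin g → Matrix (Fin d) (Fin d) ℂ)
    (h : ∀ α : Fin g → ℂ, α ≠ 0 → ∃ v : Fin d → ℂ,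
      (star v ⬝ᵥ (∑ j, α j • A j) *ᵥ v).re < 0) :
    ∃ M : ℝ, 0 ≤ M ∧ ∀ (c : ℝ) (α : Fin g → ℂ), 0 ≤ c →
      (∀ v : Fin d → ℂ,
        0 ≤ c * (star v ⬝ᵥ v).re + 2 * (star v ⬝ᵥ (∑ j, α j • A j) *ᵥ v).re) →
      ‖α‖ ≤ M * c := by
  obtain ⟨ε, hε, H⟩ := exists_uniform_neg_form A h
  refine ⟨1 / (2 * ε), by positivity, fun c α hc hα => ?_⟩
  rcases eq_or_ne α 0 with rfl | h0
  · simp only [norm_zero]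
    positivity
  have hn : 0 < ‖α‖ := norm_pos_iff.2 h0
  obtain ⟨v, hv0, hv⟩ := H (((‖α‖⁻¹ : ℝ) : ℂ) • α) (by
    simp [norm_smul, hn.ne'])
  have hpos : 0 < (star v ⬝ᵥ v).re :=
    (Complex.pos_iff.1 (Matrix.dotProduct_star_self_pos_iff.2 hv0)).1
  have e : (star v ⬝ᵥ (∑ j, (((‖α‖⁻¹ : ℝ) : ℂ) • α) j • A j) *ᵥ v).re
      = ‖α‖⁻¹ * (star v ⬝ᵥ (∑ j, α j • A j) *ᵥ v).re := by
    simp only [Pi.smul_apply, smul_assoc, ← Finset.smul_sum, Matrix.smul_mulVec,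
      dotProduct_smul]
    rw [smul_eq_mul, Complex.re_ofReal_mul]
  rw [e, inv_mul_le_iff₀ hn] at hv
  have h1 := hα v
  have h2 : 0 ≤ (c - 2 * (‖α‖ * ε)) * (star v ⬝ᵥ v).re := by nlinarith
  have h3 := nonneg_of_mul_nonneg_left h2 hpos
  rw [div_mul_eq_mul_div, le_div_iff₀ (by positivity)]
  linarith

/-- The operator norm is at most twice the numerical radius. -/
lemma ContinuousLinearMap.opNorm_le_two_mul_of_norm_inner_self_le {E : Type*}
    [NormedAddCommGroup E] [InnerProductSpace ℂ E] (T : E →L[ℂ] E) {M : ℝ} (hM : 0 ≤ M)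
    (h : ∀ x, ‖inner ℂ (T x) x‖ ≤ M * ‖x‖ ^ 2) : ‖T‖ ≤ 2 * M := by
  refine ContinuousLinearMap.opNorm_le_of_re_inner_le (by positivity) fun y x hy hx => ?_
  refine (RCLike.re_le_norm _).trans ?_
  have hpol := inner_map_polarization (T : E →ₗ[ℂ] E) x y
  simp only [ContinuousLinearMap.coe_coe] at hpol
  rw [hpol, norm_div]
  have p1 := parallelogram_law_with_norm ℂ x y
  have p2 := parallelogram_law_with_norm ℂ x (Complex.I • y)
  rw [norm_smul, Complex.norm_I, one_mul] at p2
  rw [hx, hy] at p1 p2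
  have t1 := h (x + y)
  have t2 := h (x - y)
  have t3 := h (x + Complex.I • y)
  have t4 := h (x - Complex.I • y)
  have n4 : ‖(4 : ℂ)‖ = 4 := by norm_num
  rw [n4, div_le_iff₀ (by norm_num)]
  have triangle (a b c e : ℂ) : ‖a - b + c - e‖ ≤ ‖a‖ + ‖b‖ + ‖c‖ + ‖e‖ := by
    linarith [norm_sub_le (a - b + c) e, norm_add_le (a - b) c, norm_sub_le a b]
  refine (triangle _ _ _ _).trans ?_
  rw [norm_mul, norm_mul, Complex.norm_I, one_mul, one_mul]
  nlinarith

lemma dotProduct_kronecker_mulVec {m n : Type*} [Fintype m] [Fintype n]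
    (B : Matrix m m ℂ) (Y : Matrix n n ℂ) (v : m → ℂ) (x : n → ℂ) :
    star (fun p : m × n => v p.1 * x p.2) ⬝ᵥ (B ⊗ₖ Y) *ᵥ (fun p : m × n => v p.1 * x p.2)
      = (star x ⬝ᵥ Y *ᵥ x) * (star v ⬝ᵥ B *ᵥ v) := by
  have e : (B ⊗ₖ Y) *ᵥ (fun p : m × n => v p.1 * x p.2)
      = fun p : m × n => (B *ᵥ v) p.1 * (Y *ᵥ x) p.2 := by
    ext p
    simp only [Matrix.mulVec, dotProduct, Fintype.sum_prod_type, Matrix.kroneckerMap_apply,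
      Finset.sum_mul_sum]
    exact Finset.sum_congr rfl fun i _ => Finset.sum_congr rfl fun k _ => by ring
  rw [e]
  simp only [dotProduct, Fintype.sum_prod_type, Pi.star_apply, star_mul']
  rw [mul_comm, Finset.sum_mul_sum]
  exact Finset.sum_congr rfl fun i _ => Finset.sum_congr rfl fun k _ => by ring

lemma re_dotProduct_add_conjTranspose_mulVec {m : Type*} [Fintype m]
    (B : Matrix m m ℂ) (v : m → ℂ) :
    (star v ⬝ᵥ (B + Bᴴ) *ᵥ v).re = 2 * (star v ⬝ᵥ B *ᵥ v).re := by
  have : star v ⬝ᵥ Bᴴ *ᵥ v = star (star v ⬝ᵥ B *ᵥ v) := by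
    rw [Matrix.star_dotProduct, Matrix.star_mulVec, Matrix.conjTranspose_conjTranspose,
      ← Matrix.dotProduct_mulVec]
  rw [Matrix.add_mulVec, dotProduct_add, this, Complex.add_re]
  simp [two_mul]

lemma sum_smul_add_sum_conj_smul_conjTranspose {g d : ℕ}
    (A : Fin g → Matrix (Fin d) (Fin d) ℂ) (α : Fin g → ℂ) :
    ∑ j, α j • A j + ∑ j, (starRingEnd ℂ) (α j) • (A j)ᴴ
      = (∑ j, α j • A j) + (∑ j, α j • A j)ᴴ := by
  simp [Matrix.conjTranspose_sum, Matrix.conjTranspose_smul]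

/-- Compressing a positive semidefinite pencil by a vector gives a scalar point. -/
lemma pencil_compression_nonneg {g d n : ℕ} (A : Fin g → Matrix (Fin d) (Fin d) ℂ)
    (X : Fin g → Matrix (Fin n) (Fin n) ℂ) (hX : (pencil A X).PosSemidef)
    (x : Fin n → ℂ) (v : Fin d → ℂ) :
    0 ≤ (star x ⬝ᵥ x).re * (star v ⬝ᵥ v).re
      + 2 * (star v ⬝ᵥ (∑ j, (star x ⬝ᵥ X j *ᵥ x) • A j) *ᵥ v).re := by
  have h := (Complex.nonneg_iff.1
    (hX.dotProduct_mulVec_nonneg (fun p : Fin d × Fin n => v p.1 * x p.2))).1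
  rw [pencil, add_assoc, Matrix.add_mulVec, dotProduct_add, Complex.add_re,
    re_dotProduct_add_conjTranspose_mulVec, ← Matrix.one_kronecker_one,
    dotProduct_kronecker_mulVec, Matrix.one_mulVec, Matrix.one_mulVec, Complex.mul_re,
    ← (Complex.nonneg_iff.1 (dotProduct_star_self_nonneg x)).2, zero_mul, sub_zero, lamEval,
    Matrix.sum_mulVec, dotProduct_sum] at h
  simp only [dotProduct_kronecker_mulVec] at h
  simpa only [Matrix.sum_mulVec, dotProduct_sum, Matrix.smul_mulVec, dotProduct_smul,
    smul_eq_mul] using h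

lemma boundedFS_of_form_neg {g d : ℕ} (A : Fin g → Matrix (Fin d) (Fin d) ℂ)
    (h : ∀ α : Fin g → ℂ, α ≠ 0 → ∃ v : Fin d → ℂ,
      (star v ⬝ᵥ (∑ j, α j • A j) *ᵥ v).re < 0) : BoundedFS A := by
  obtain ⟨M, hM, H⟩ := exists_norm_le_of_form_nonneg A h
  refine ⟨2 * M, fun n X hX j => ?_⟩
  refine ContinuousLinearMap.opNorm_le_two_mul_of_norm_inner_self_le _ hM fun x => ?_
  have hx := H (star x.ofLp ⬝ᵥ x.ofLp).re (fun j => star x.ofLp ⬝ᵥ X j *ᵥ x.ofLp)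
    (Complex.nonneg_iff.1 (dotProduct_star_self_nonneg _)).1
    (pencil_compression_nonneg A X hX x.ofLp)
  have hn : (star x.ofLp ⬝ᵥ x.ofLp).re = ‖x‖ ^ 2 := by
    rw [← inner_self_eq_norm_sq (𝕜 := ℂ), EuclideanSpace.inner_eq_star_dotProduct,
      dotProduct_comm]
    rfl
  rw [hn] at hx
  refine le_trans (le_of_eq ?_) ((norm_le_pi_norm _ j).trans hx)
  rw [norm_inner_symm, EuclideanSpace.inner_eq_star_dotProduct, Matrix.ofLp_toEuclideanCLM,
    dotProduct_comm]

lemma not_boundedFS_of_posSemidef {g d : ℕ} (A : Fin g → Matrix (Fin d) (Fin d) ℂ)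
    {α : Fin g → ℂ} (hα : α ≠ 0)
    (h : ((∑ j, α j • A j) + (∑ j, α j • A j)ᴴ).PosSemidef) : ¬ BoundedFS A := by
  rintro ⟨N, hN⟩
  obtain ⟨j, hj⟩ := Function.ne_iff.1 hα
  have hj' : 0 < ‖α j‖ := norm_pos_iff.2 hj
  set t : ℝ := (|N| + 1) / ‖α j‖ with ht
  have ht0 : 0 ≤ t := by positivity
  have hP : (pencil A fun j => ((t : ℂ) * α j) • (1 : Matrix (Fin 1) (Fin 1) ℂ)).PosSemidef := by
    have e : pencil A (fun j => ((t : ℂ) * α j) • (1 : Matrix (Fin 1) (Fin 1) ℂ))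
        = 1 + (t : ℂ) • (((∑ j, α j • A j) + (∑ j, α j • A j)ᴴ) ⊗ₖ
          (1 : Matrix (Fin 1) (Fin 1) ℂ)) := by
      have e1 : lamEval A (fun j => ((t : ℂ) * α j) • (1 : Matrix (Fin 1) (Fin 1) ℂ))
          = (t : ℂ) • ((∑ j, α j • A j) ⊗ₖ (1 : Matrix (Fin 1) (Fin 1) ℂ)) := by
        ext p q
        simp only [lamEval, Matrix.sum_apply, Matrix.smul_apply, Matrix.kroneckerMap_apply,
          smul_eq_mul, Finset.sum_mul, Finset.mul_sum]
        exact Finset.sum_congr rfl fun i _ => by ring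
      rw [pencil, e1, Matrix.add_kronecker, smul_add, add_assoc, Matrix.conjTranspose_smul,
        Matrix.conjTranspose_kronecker, Matrix.conjTranspose_one]
      simp
    rw [e]
    exact Matrix.PosSemidef.one.add
      ((h.kronecker Matrix.PosSemidef.one).smul (by exact_mod_cast ht0))
  have h1 := hN 1 _ hP j
  rw [opN, map_smul, map_one, norm_smul, norm_one, mul_one, norm_mul, Complex.norm_real,
    Real.norm_of_nonneg ht0, ht, div_mul_cancel₀ _ hj'.ne'] at h1
  linarith [le_abs_self N]

lemma Matrix.IsHermitian.exists_neg_eigenvalue_of_not_posSemidef {d : ℕ}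
    {H : Matrix (Fin d) (Fin d) ℂ} (hH : H.IsHermitian) (h : ¬ H.PosSemidef) :
    ∃ (μ : ℝ) (v : Fin d → ℂ), μ < 0 ∧ v ≠ 0 ∧ H.mulVec v = (μ : ℂ) • v := by
  rw [hH.posSemidef_iff_eigenvalues_nonneg, Pi.le_def] at h
  push Not at h
  obtain ⟨i, hi⟩ := h
  refine ⟨hH.eigenvalues i, (hH.eigenvectorBasis i).ofLp, hi, fun h0 => ?_, ?_⟩
  · exact hH.eigenvectorBasis.orthonormal.ne_zero i (by ext k; exact congrFun h0 k)
  · exact hH.mulVec_eigenvectorBasis i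

/-- The free spectrahedron `D_A` is bounded if and only if for every nonzero `α ∈ ℂ^g` the
Hermitian matrix `Λ_A(α) + Λ_A(α)^* = Σ_j α_j A_j + Σ_j conj(α_j) A_j^*` has both a strictly
positive and a strictly negative eigenvalue. -/
theorem bounded_iff_pos_and_neg_eigenvalues {d g : ℕ}
    (A : Fin g → Matrix (Fin d) (Fin d) ℂ) :
    BoundedFS A ↔
      ∀ α : Fin g → ℂ, α ≠ 0 →
        (∃ (μ : ℝ) (v : Fin d → ℂ), 0 < μ ∧ v ≠ 0 ∧
          (∑ j : Fin g, α j • A j + ∑ j : Fin g, (starRingEnd ℂ) (α j) • (A j)ᴴ).mulVec v =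
            (μ : ℂ) • v) ∧
        (∃ (μ : ℝ) (v : Fin d → ℂ), μ < 0 ∧ v ≠ 0 ∧
          (∑ j : Fin g, α j • A j + ∑ j : Fin g, (starRingEnd ℂ) (α j) • (A j)ᴴ).mulVec v =
            (μ : ℂ) • v) := by
  simp only [sum_smul_add_sum_conj_smul_conjTranspose]
  constructor
  · intro hb
    have key : ∀ α : Fin g → ℂ, α ≠ 0 → ∃ (μ : ℝ) (v : Fin d → ℂ), μ < 0 ∧ v ≠ 0 ∧
        ((∑ j, α j • A j) + (∑ j, α j • A j)ᴴ).mulVec v = (μ : ℂ) • v := fun α hα =>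
      (Matrix.isHermitian_add_transpose_self _).exists_neg_eigenvalue_of_not_posSemidef
        fun h => not_boundedFS_of_posSemidef A hα h hb
    refine fun α hα => ⟨?_, key α hα⟩
    obtain ⟨μ, v, hμ, hv, e⟩ := key (-α) (neg_ne_zero.2 hα)
    refine ⟨-μ, v, neg_pos.2 hμ, hv, ?_⟩
    simp only [Pi.neg_apply, neg_smul, Finset.sum_neg_distrib, Matrix.conjTranspose_neg,
      ← neg_add, Matrix.neg_mulVec] at e
    rw [Complex.ofReal_neg, neg_smul, ← e, neg_neg]
  · intro h
    refine boundedFS_of_form_neg A fun α hα => ?_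
    obtain ⟨μ, v, hμ, hv, e⟩ := (h α hα).2
    refine ⟨v, ?_⟩
    have h2 := re_dotProduct_add_conjTranspose_mulVec (∑ j, α j • A j) v
    rw [e, dotProduct_smul, smul_eq_mul, Complex.re_ofReal_mul] at h2
    have hpos : 0 < (star v ⬝ᵥ v).re :=
      (Complex.pos_iff.1 (Matrix.dotProduct_star_self_pos_iff.2 hv)).1
    nlinarith [mul_neg_of_neg_of_pos hμ hpos]
end

section
/- Suppose A, B ∈ M_d(ℂ)^g with {A_1,…,A_g} linearly independent. Let p be given by scalar coefficients p^j_α ∈ ℂ (indexed by 1 ≤ j ≤ g and words α in g letters) with p^j_∅ = 0 and p^j equal to δ_{jk} on the single-letter word k (i.e., p(0) = 0 and p′(0) = I), let W be given by matrix coefficients W_α ∈ M_d(ℂ), and set G_∅ = 0 and G_{x_kα} = Σ_{j=1}^g p^j_{x_kα} B_j (so that G = Λ_B(p(x)) as a formal power series). Suppose the one-term Positivstellensatz coefficient identities hold: for all words α, β and all 1 ≤ j,k ≤ g, W_β^* A_k^* W_{x_jα} + W_{x_kβ}^* A_j W_α + W_{x_kβ}^* W_{x_jα} = 0, W_∅^*(A_k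 W_α + W_{x_kα}) = G_{x_kα}, and W_∅^* W_∅ = I (formally, L_B(p(x)) = W(x)^* L_A(x) W(x)). Then there exist d×d unitary matrices C and 𝒲 such that: (1) B_j = 𝒲^* C A_j 𝒲 for each j; (2) for all j, k the matrix A_k (C−I) A_j lies in the span of {A_1,…,A_g}, so that in particular the matrices R_j = (C−I)A_j span an algebra and the span of {A_1,…,A_g} is a right module over it; and (3) with Ξ = (Ξ_1,…,Ξ_g) the g×g matrices determined by A_k(C−I)A_j = Σ_{s=1}^g (Ξ_j)_{k,s} A_s, the tuple Ξ is convexotonic and p^j_{x_kω} = (Ξ^ω)_{k,j} for every word ω and all 1 ≤ j,k ≤ g — that is, p is the convexotonic map x(I − Λ_Ξ(x))^{-1} associated to Ξ. -/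
open scoped Matrix

/-- Two families of vectors with the same Gram matrix in a finite-dimensional inner product space
differ by a linear isometry. -/
theorem exists_linearIsometry_apply_eq_of_inner_eq {ι E : Type*} [NormedAddCommGroup E]
    [InnerProductSpace ℂ E] [FiniteDimensional ℂ E] (v w : ι → E)
    (h : ∀ i j, inner ℂ (v i) (v j) = inner ℂ (w i) (w j)) :
    ∃ L : E →ₗᵢ[ℂ] E, ∀ i, L (v i) = w i := by
  set F := Finsupp.linearCombination ℂ v
  set H := Finsupp.linearCombination ℂ w
  have hnorm : ∀ m, ‖F m‖ = ‖H m‖ := by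
    intro m
    rw [@norm_eq_sqrt_re_inner ℂ, @norm_eq_sqrt_re_inner ℂ _ _ _ _ (H m)]
    simp only [F, H, Finsupp.linearCombination_apply, Finsupp.sum, sum_inner, inner_sum,
      inner_smul_left, inner_smul_right, h]
  obtain ⟨s, hs⟩ := F.rangeRestrict.exists_rightInverse_of_surjective F.range_rangeRestrict
  have hFs : ∀ x, F (s x) = x := fun x => congrArg Subtype.val (LinearMap.congr_fun hs x)
  let L₀ : LinearMap.range F →ₗᵢ[ℂ] E :=
    ⟨H ∘ₗ s, fun x => by
      rw [LinearMap.comp_apply, ← hnorm, hFs, Submodule.coe_norm]⟩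
  refine ⟨L₀.extend, fun i => ?_⟩
  have hv : F (Finsupp.single i 1) = v i := by simp [F]
  have hw : H (Finsupp.single i 1) = w i := by simp [H]
  have hext := L₀.extend_apply ⟨F (Finsupp.single i 1), LinearMap.mem_range_self _ _⟩
  simp only [hv] at hext
  rw [hext, ← hw, ← sub_eq_zero, ← norm_eq_zero]
  change ‖H (s _) - H _‖ = 0
  rw [← map_sub, ← hnorm, map_sub]
  simp only [hFs, hv, sub_self, norm_zero]

/-- Two families of square matrices with the same products `(X i)ᴴ * X j` differ by left
multiplication by a unitary matrix. -/
theorem exists_unitary_mul_eq_of_conjTranspose_mul_eq {ι n : Type*} [Fintype n] [DecidableEq n]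
    (X Y : ι → Matrix n n ℂ) (h : ∀ i j, (X i)ᴴ * X j = (Y i)ᴴ * Y j) :
    ∃ C ∈ Matrix.unitaryGroup n ℂ, ∀ i, C * X i = Y i := by
  have hinner : ∀ (Z : ι → Matrix n n ℂ) (a b : ι × n),
      inner ℂ (WithLp.toLp 2 ((Z a.1).col a.2)) (WithLp.toLp 2 ((Z b.1).col b.2)) =
        ((Z a.1)ᴴ * Z b.1) a.2 b.2 := by
    intro Z a b
    simp [PiLp.inner_apply, Matrix.mul_apply, mul_comm]
  obtain ⟨L, hL⟩ := exists_linearIsometry_apply_eq_of_inner_eq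
    (fun a : ι × n => WithLp.toLp 2 ((X a.1).col a.2))
    (fun a : ι × n => WithLp.toLp 2 ((Y a.1).col a.2))
    (fun a b => by rw [hinner, hinner, h])
  set e := Matrix.toEuclideanCLM (n := n) (𝕜 := ℂ)
  refine ⟨e.symm L.toContinuousLinearMap, ?_, fun i => ?_⟩
  · rw [Matrix.mem_unitaryGroup_iff']
    apply EquivLike.injective e
    rw [map_mul, map_star, e.apply_symm_apply, map_one,
      ContinuousLinearMap.star_eq_adjoint, ContinuousLinearMap.mul_def,
      (ContinuousLinearMap.norm_map_iff_adjoint_comp_self _).mp L.norm_map]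
  · ext a b
    have hcol := hL (i, b)
    rw [← L.coe_toContinuousLinearMap, ← e.apply_symm_apply L.toContinuousLinearMap] at hcol
    exact congrArg (fun u : EuclideanSpace ℂ n => u a) hcol

/-- Consequences of a square one-term Positivstellensatz `L_B(p(x)) = W(x)^* L_A(x) W(x)`:
if `{A_1,…,A_g}` is linearly independent, `p` is a formal power series map with `p(0) = 0`
and `p′(0) = I`, and the coefficient identities of the one-term certificate hold, then there
are `d × d` unitaries `C` and `𝒲` such that `B_j = 𝒲^* C A_j 𝒲`, each `A_k (C−I) A_j`
lies in the span of the `A_s` with structure matrices `Ξ` (so that the `R_j = (C−I)A_j` span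
an algebra and the span of the `A_j` is a right module over it), the tuple `Ξ` is
convexotonic, and `p` is the convexotonic map associated to `Ξ`:
`p^j_{x_k ω} = (Ξ^ω)_{k,j}`. -/
theorem one_term_certificate_forces_convexotonic {d g : ℕ}
    (A B : Fin g → Matrix (Fin d) (Fin d) ℂ)
    (hind : LinearIndependent ℂ A)
    (p : Fin g → List (Fin g) → ℂ)
    (hp0 : ∀ j : Fin g, p j [] = 0)
    (hp1 : ∀ j k : Fin g, p j [k] = if j = k then 1 else 0)
    (W : List (Fin g) → Matrix (Fin d) (Fin d) ℂ)
    (G : List (Fin g) → Matrix (Fin d) (Fin d) ℂ)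
    (hG0 : G [] = 0)
    (hG : ∀ (k : Fin g) (α : List (Fin g)),
      G (k :: α) = ∑ j : Fin g, p j (k :: α) • B j)
    (hid1 : ∀ (α β : List (Fin g)) (j k : Fin g),
      (W β)ᴴ * (A k)ᴴ * W (j :: α) + (W (k :: β))ᴴ * A j * W α +
        (W (k :: β))ᴴ * W (j :: α) = 0)
    (hid2 : ∀ (k : Fin g) (α : List (Fin g)),
      (W [])ᴴ * (A k * W α + W (k :: α)) = G (k :: α))
    (hid3 : (W [])ᴴ * W [] = 1) :
    ∃ C 𝒲 : Matrix (Fin d) (Fin d) ℂ,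
      C ∈ Matrix.unitaryGroup (Fin d) ℂ ∧
      𝒲 ∈ Matrix.unitaryGroup (Fin d) ℂ ∧
      (∀ j : Fin g, B j = 𝒲ᴴ * C * A j * 𝒲) ∧
      ∃ Ξ : Fin g → Matrix (Fin g) (Fin g) ℂ,
        (∀ j k : Fin g, A k * ((C - 1) * A j) = ∑ s : Fin g, (Ξ j) k s • A s) ∧
        (∀ j k : Fin g, ((C - 1) * A k) * ((C - 1) * A j) =
          ∑ s : Fin g, (Ξ j) k s • ((C - 1) * A s)) ∧
        Convexotonic Ξ ∧
        (∀ (ω : List (Fin g)) (j k : Fin g), p j (k :: ω) = (wordProd Ξ ω) k j) := by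
  obtain ⟨C, hC, hCW⟩ := exists_unitary_mul_eq_of_conjTranspose_mul_eq
    (fun q : Fin g × List (Fin g) => A q.1 * W q.2)
    (fun q => A q.1 * W q.2 + W (q.1 :: q.2)) (by
      rintro ⟨k, β⟩ ⟨j, α⟩
      have := hid1 α β j k
      simp only [Matrix.conjTranspose_add, Matrix.conjTranspose_mul, add_mul, mul_add,
        mul_assoc] at this ⊢
      rw [eq_comm, ← sub_eq_zero, ← this]
      abel)
  have hW' : W [] * (W [])ᴴ = 1 := mul_eq_one_comm.mp hid3
  have hC' : Cᴴ * C = 1 := Matrix.mem_unitaryGroup_iff'.mp hC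
  have hWstep : ∀ j α, W (j :: α) = (C - 1) * A j * W α := by
    intro j α
    have := hCW (j, α)
    simp only at this
    rw [mul_assoc, sub_mul, one_mul, this, add_sub_cancel_left]
  have hWprod : ∀ α, W α = wordProd (fun j => (C - 1) * A j) α * W [] := by
    intro α
    induction α with
    | nil => simp [wordProd]
    | cons j α ih => rw [hWstep, ih]; simp [wordProd, mul_assoc]
  have hGC : ∀ k α, (W [])ᴴ * (C * (A k * W α)) = ∑ j, p j (k :: α) • B j := by
    intro k α
    rw [← hG, ← hid2, ← hCW (k, α)]
  have hB : ∀ k, B k = (W [])ᴴ * C * A k * W [] := by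
    intro k
    have := hGC k []
    simpa [hp1, mul_assoc, eq_comm] using this
  have hA : ∀ k α, A k * wordProd (fun j => (C - 1) * A j) α =
      ∑ s, p s (k :: α) • A s := by
    intro k α
    have hk := congrArg (fun M => Cᴴ * (W [] * M) * (W [])ᴴ) (hGC k α)
    have hcancel : ∀ M, Cᴴ * (W [] * ((W [])ᴴ * (C * (M * W [])))) * (W [])ᴴ = M := by
      intro M
      rw [← mul_assoc (W []), hW', one_mul, ← mul_assoc Cᴴ, hC', one_mul, mul_assoc, hW',
        mul_one]
    have hsum : ∑ j, p j (k :: α) • B j =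
        (W [])ᴴ * (C * ((∑ j, p j (k :: α) • A j) * W [])) := by
      simp only [hB, Finset.sum_mul, Finset.mul_sum, smul_mul_assoc, mul_smul_comm, mul_assoc]
    rw [hsum, hWprod α, ← mul_assoc (A k)] at hk
    simpa only [hcancel] using hk
  set Ξ : Fin g → Matrix (Fin g) (Fin g) ℂ := fun j => Matrix.of fun k s => p s [k, j]
  have hAR : ∀ j k, A k * ((C - 1) * A j) = ∑ s, (Ξ j) k s • A s := by
    intro j k
    have := hA k [j]
    simpa [wordProd, Ξ] using this
  have hRR : ∀ j k, ((C - 1) * A k) * ((C - 1) * A j) =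
      ∑ s, (Ξ j) k s • ((C - 1) * A s) := by
    intro j k
    rw [mul_assoc, hAR, Finset.mul_sum]
    simp only [mul_smul_comm]
  have hcoeff : ∀ a b : Fin g → ℂ, ∑ s, a s • A s = ∑ s, b s • A s → a = b :=
    fun a b hab => funext fun s => by
      have := Fintype.linearIndependent_iff.mp hind (a - b)
        (by simp [sub_smul, Finset.sum_sub_distrib, hab]) s
      simpa [sub_eq_zero] using this
  have hcomb : ∀ (a : Fin g → ℂ) (j : Fin g),
      (∑ s, a s • A s) * ((C - 1) * A j) = ∑ t, (a ᵥ* Ξ j) t • A t := by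
    intro a j
    simp only [Finset.sum_mul, smul_mul_assoc, hAR, Finset.smul_sum, Matrix.vecMul, dotProduct,
      Finset.sum_smul, smul_smul]
    exact Finset.sum_comm
  have hword : ∀ (ω : List (Fin g)) (a : Fin g → ℂ),
      (∑ s, a s • A s) * wordProd (fun j => (C - 1) * A j) ω =
        ∑ t, (a ᵥ* wordProd Ξ ω) t • A t := by
    intro ω
    induction ω with
    | nil => simp [wordProd]
    | cons j ω ih =>
      intro a
      have hcons : ∀ {n : ℕ} (T : Fin g → Matrix (Fin n) (Fin n) ℂ),
          wordProd T (j :: ω) = T j * wordProd T ω := fun T => by simp [wordProd]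
      rw [hcons, hcons, ← mul_assoc, hcomb, ih, Matrix.vecMul_vecMul]
  refine ⟨C, W [], hC, Matrix.mem_unitaryGroup_iff'.mpr hid3, hB, Ξ, hAR, hRR, ?_, ?_⟩
  · intro j k
    ext l t
    have hl : A l * (((C - 1) * A k) * ((C - 1) * A j)) =
        ∑ t, (Ξ k * Ξ j) l t • A t := by
      rw [← mul_assoc, hAR, hcomb]
      rfl
    have hr : A l * (((C - 1) * A k) * ((C - 1) * A j)) =
        ∑ t, (∑ s, (Ξ j) k s • Ξ s) l t • A t := by
      rw [hRR, Finset.mul_sum]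
      simp only [mul_smul_comm, hAR, Finset.smul_sum, Matrix.sum_apply, Matrix.smul_apply,
        Finset.sum_smul, smul_smul, smul_eq_mul]
      exact Finset.sum_comm
    exact congrFun (hcoeff _ _ (hl.symm.trans hr)) t
  · intro ω j k
    have hk := hword ω (Pi.single k 1)
    rw [Matrix.single_one_vecMul] at hk
    simp only [Pi.single_apply, ite_smul, one_smul, zero_smul, Finset.sum_ite_eq',
      Finset.mem_univ, if_true, hA] at hk
    exact congrFun (hcoeff (fun s => p s (k :: ω)) _ hk) j
end
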